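/- arXiv:math/0310498 — 5 statements merged into one kernel-verified Lean document; each statement's English description precedes it below -/
import Mathlib

section
/- Let r ≥ 2 and λ ≥ 2 be integers, let q < q₁ be reals, and let f, g be C^r diffeomorphisms of the half-open interval [q,q₁) fixing q, such that g has no fixed point in (q,q₁), f ∘ g = g^[λ] ∘ f on [q,q₁), and f′(q) ≤ (1/λ)^{1/(r−1)}. Then there exists an integer s with 1 ≤ s ≤ r−1 such that f′(q) = (1/λ)^{1/s} and the (s+1)-st one-sided derivative of g at q is nonzero; in particular g is not r-flat at q, i.e. it is not the case that g(x) − x = o((x−q)^r) as x → q⁺. -/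
open Filter Set Topology Asymptotics
open scoped ContDiff

noncomputable section

/-- A `C^r` diffeomorphism of the half-open interval `[q, q₁)`: a bijection of `[q, q₁)`
onto itself which is `C^r` on `[q, q₁)` (derivatives one-sided at `q`) with strictly
positive derivative. -/
def IsCrDiffeoOnIco (r : WithTop ℕ∞) (f : ℝ → ℝ) (q q₁ : ℝ) : Prop :=
  Set.BijOn f (Set.Ico q q₁) (Set.Ico q q₁) ∧ ContDiffOn ℝ r f (Set.Ico q q₁) ∧
    ∀ x ∈ Set.Ico q q₁, 0 < derivWithin f (Set.Ico q q₁) x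

/-- A `C²` function on `[q, q₁)` differs from its linear part at `q` by a function whose
Lipschitz constant near `q` is proportional to the distance to `q`. -/
lemma isBigO_sub_sub_derivWithin_mul {q q₁ : ℝ} (hq : q < q₁) {f : ℝ → ℝ}
    (hf : ContDiffOn ℝ 2 f (Ico q q₁)) :
    (fun p : ℝ × ℝ => f p.1 - f p.2 - derivWithin f (Ico q q₁) q * (p.1 - p.2))
      =O[𝓝[≥] q ×ˢ 𝓝[≥] q] fun p => (|p.1 - q| + |p.2 - q|) * (p.1 - p.2) := by
  set a := derivWithin f (Ico q q₁) q with ha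
  have hqS : q ∈ Ico q q₁ := left_mem_Ico.2 hq
  have h1 : DifferentiableWithinAt ℝ (derivWithin f (Ico q q₁)) (Ico q q₁) q :=
    ((hf.derivWithin (m := 1) (uniqueDiffOn_Ico q q₁) (by norm_num)).differentiableOn
      (by norm_num)) q hqS
  have h2 := h1.hasDerivWithinAt.isBigO_sub
  rw [nhdsWithin_Ico_eq_nhdsGE hq] at h2
  obtain ⟨K, hK0, hK⟩ := h2.exists_pos
  have hK' := hK.bound
  rw [prod_pure, eventually_map] at hK'
  obtain ⟨u, hu, hsub⟩ := mem_nhdsGE_iff_exists_Ico_subset.1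
    (inter_mem hK' (Ico_mem_nhdsGE hq))
  have hIco := Ico_mem_nhdsGE (show q < u from hu)
  refine IsBigO.of_bound K ?_
  filter_upwards [prod_mem_prod hIco hIco] with p hp
  obtain ⟨x, y⟩ := p
  obtain ⟨hx, hy⟩ := hp
  simp only at hx hy
  have hmax : max x y < u := max_lt hx.2 hy.2
  have hd : ∀ z ∈ Icc q (max x y), HasDerivWithinAt (fun z => f z - a * z)
      (derivWithin f (Ico q q₁) z - a) (Icc q (max x y)) z := by
    intro z hz
    have hzS : z ∈ Ico q q₁ := (hsub ⟨hz.1, hz.2.trans_lt hmax⟩).2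
    have := ((hf.differentiableOn (by norm_num)) z hzS).hasDerivWithinAt
    have h3 := this.sub ((hasDerivWithinAt_id z _).const_mul a)
    simp only [mul_one] at h3
    exact h3.mono fun w hw => (hsub ⟨hw.1, hw.2.trans_lt hmax⟩).2
  have hb : ∀ z ∈ Icc q (max x y), ‖derivWithin f (Ico q q₁) z - a‖ ≤ K * (max x y - q) := by
    intro z hz
    have h4 : ‖derivWithin f (Ico q q₁) z - derivWithin f (Ico q q₁) q‖ ≤ K * ‖z - q‖ :=
      (hsub ⟨hz.1, hz.2.trans_lt hmax⟩).1
    refine h4.trans ?_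
    rw [Real.norm_of_nonneg (sub_nonneg.2 hz.1)]
    have := hz.2
    gcongr
  have h5 := (convex_Icc q (max x y)).norm_image_sub_le_of_norm_hasDerivWithin_le hd hb
    ⟨hy.1, le_max_right _ _⟩ ⟨hx.1, le_max_left _ _⟩
  have h6 : max x y - q ≤ |x - q| + |y - q| := by
    rw [abs_of_nonneg (sub_nonneg.2 hx.1), abs_of_nonneg (sub_nonneg.2 hy.1)]
    have := hx.1
    have := hy.1
    rcases max_cases x y with h | h <;> linarith
  have h7 : f x - f y - a * (x - y) = f x - a * x - (f y - a * y) := by ring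
  rw [h7, norm_mul, ← mul_assoc]
  refine h5.trans ?_
  rw [Real.norm_of_nonneg (add_nonneg (abs_nonneg _) (abs_nonneg _))]
  gcongr

/-- The iterates of a map tangent to the identity at `q` move points, to first order, by
multiples of the displacement of the map. -/
lemma isBigO_iterate_sub_sub_mul {q : ℝ} {g : ℝ → ℝ}
    (hgt : Tendsto g (𝓝[>] q) (𝓝[>] q)) (hgO : (fun x => g x - q) =O[𝓝[>] q] fun x => x - q)
    (hg : (fun p : ℝ × ℝ => g p.1 - g p.2 - (p.1 - p.2))
      =O[𝓝[>] q ×ˢ 𝓝[>] q] fun p => (|p.1 - q| + |p.2 - q|) * (p.1 - p.2)) (n : ℕ) :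
    (fun x => g^[n] x - x - n * (g x - x)) =O[𝓝[>] q] fun x => (x - q) * (g x - x) := by
  have hit : ∀ n : ℕ, Tendsto g^[n] (𝓝[>] q) (𝓝[>] q) := fun n => by
    induction n with
    | zero => exact tendsto_id
    | succ n ih => exact ih.comp hgt
  have hitO : ∀ n : ℕ, (fun x => g^[n] x - q) =O[𝓝[>] q] fun x => x - q := fun n => by
    induction n with
    | zero => exact isBigO_refl _ _
    | succ n ih => exact (ih.comp_tendsto hgt).trans hgO
  have hsmall : (fun x => x - q) =O[𝓝[>] q] fun _ => (1 : ℝ) := by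
    have : Tendsto (fun x => x - q) (𝓝[>] q) (𝓝 (q - q)) :=
      ((continuous_id.sub continuous_const).tendsto q).mono_left nhdsWithin_le_nhds
    exact this.isBigO_one ℝ
  induction n with
  | zero => simpa using isBigO_zero _ _
  | succ n ih =>
    have h1 : (fun x => g^[n] x - x) =O[𝓝[>] q] fun x => g x - x := by
      have h2 : (fun x => (x - q) * (g x - x)) =O[𝓝[>] q] fun x => g x - x := by
        simpa using hsmall.mul (isBigO_refl (fun x => g x - x) _)
      have h3 := (ih.trans h2).add
        ((isBigO_refl (fun x => g x - x) (𝓝[>] q)).const_mul_left (n : ℝ))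
      simpa using h3
    have h4 := hg.comp_tendsto ((hit n).prodMk tendsto_id)
    have h5 : (fun x => (|g^[n] x - q| + |x - q|) * (g^[n] x - x)) =O[𝓝[>] q]
        fun x => (x - q) * (g x - x) :=
      ((hitO n).abs_left.add (isBigO_refl (fun x => x - q) _).abs_left).mul h1
    refine ((h4.trans h5).add ih).congr_left fun x => ?_
    simp only [Function.comp_apply, id, Function.iterate_succ_apply']
    push_cast
    ring

/-- The displacement `u(x) = g(x) - x` satisfies `l u(f x) = a u(x)` to first order when
`f ∘ g = g^[l] ∘ f`. -/
lemma isBigO_displacement_comp {q a : ℝ} {l : ℕ} {f g : ℝ → ℝ}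
    (hft : Tendsto f (𝓝[>] q) (𝓝[>] q)) (hfO : (fun x => f x - q) =O[𝓝[>] q] fun x => x - q)
    (hgt : Tendsto g (𝓝[>] q) (𝓝[>] q)) (hgO : (fun x => g x - q) =O[𝓝[>] q] fun x => x - q)
    (hf : (fun p : ℝ × ℝ => f p.1 - f p.2 - a * (p.1 - p.2))
      =O[𝓝[>] q ×ˢ 𝓝[>] q] fun p => (|p.1 - q| + |p.2 - q|) * (p.1 - p.2))
    (hg : (fun p : ℝ × ℝ => g p.1 - g p.2 - (p.1 - p.2))
      =O[𝓝[>] q ×ˢ 𝓝[>] q] fun p => (|p.1 - q| + |p.2 - q|) * (p.1 - p.2))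
    (hrel : ∀ᶠ x in 𝓝[>] q, f (g x) = g^[l] (f x)) :
    (fun x => l * (g (f x) - f x) - a * (g x - x)) =O[𝓝[>] q]
      fun x => (x - q) * (|g x - x| + |g (f x) - f x|) := by
  have h1 : (fun x => f (g x) - f x - a * (g x - x)) =O[𝓝[>] q]
      fun x => (x - q) * (g x - x) :=
    (hf.comp_tendsto (hgt.prodMk tendsto_id)).trans
      ((hgO.abs_left.add (isBigO_refl (fun x => x - q) _).abs_left).mul (isBigO_refl _ _))
  have h2 : (fun x => g^[l] (f x) - f x - l * (g (f x) - f x)) =O[𝓝[>] q]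
      fun x => (x - q) * (g (f x) - f x) :=
    ((isBigO_iterate_sub_sub_mul hgt hgO hg l).comp_tendsto hft).trans
      (hfO.mul (isBigO_refl _ _))
  have h3 : (fun x => (x - q) * (g x - x)) =O[𝓝[>] q]
      fun x => (x - q) * (|g x - x| + |g (f x) - f x|) :=
    (isBigO_refl _ _).mul (isBigO_of_le _ fun x => by
      simp only [Real.norm_eq_abs]
      exact (le_add_of_nonneg_right (abs_nonneg _)).trans (le_abs_self _))
  have h4 : (fun x => (x - q) * (g (f x) - f x)) =O[𝓝[>] q]
      fun x => (x - q) * (|g x - x| + |g (f x) - f x|) :=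
    (isBigO_refl _ _).mul (isBigO_of_le _ fun x => by
      simp only [Real.norm_eq_abs]
      exact (le_add_of_nonneg_left (abs_nonneg _)).trans (le_abs_self _))
  refine ((h1.trans h3).sub (h2.trans h4)).congr' ?_ EventuallyEq.rfl
  filter_upwards [hrel] with x hx
  rw [hx]
  ring

/-- One step of the comparison between `V / t ^ r` and `W / y ^ r`, where `y` is at most `a t` and
`l W` is at least `a V`, up to relative errors `K t`. -/
lemma mul_pow_le_mul_pow_mul_exp {a K t y V W : ℝ} {l r : ℕ} (ha : 0 < a) (hK : 0 < K)
    (ht : 0 < t) (hy : 0 < y) (hV : 0 ≤ V) (hW : 0 ≤ W) (hr : 1 ≤ r)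
    (hla : l * a ^ (r - 1) ≤ 1) (hKt : K * t ≤ 1 / 2) (hyt : y ≤ a * t * (K * t + 1))
    (hVW : (1 - K * t) * (a * V) ≤ (K * t + 1) * (l * W)) :
    V * y ^ r ≤ W * t ^ r * Real.exp ((r + 3) * K * t) := by
  have h0 : 0 < K * t := by positivity
  have e1 : K * t + 1 ≤ Real.exp (K * t) := Real.add_one_le_exp (K * t)
  have e2 : 1 ≤ (1 - K * t) * Real.exp (2 * (K * t)) := by
    have h10 : (1 - K * t) * (2 * (K * t) + 1) ≤ (1 - K * t) * Real.exp (2 * (K * t)) :=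
      mul_le_mul_of_nonneg_left (Real.add_one_le_exp (2 * (K * t))) (by linarith)
    nlinarith
  have hvv : a * V ≤ l * W * Real.exp (3 * (K * t)) :=
    calc a * V ≤ (1 - K * t) * Real.exp (2 * (K * t)) * (a * V) :=
          le_mul_of_one_le_left (by positivity) e2
      _ = Real.exp (2 * (K * t)) * ((1 - K * t) * (a * V)) := by ring
      _ ≤ Real.exp (2 * (K * t)) * ((K * t + 1) * (l * W)) := by gcongr
      _ ≤ Real.exp (2 * (K * t)) * (Real.exp (K * t) * (l * W)) := by gcongr
      _ = l * W * Real.exp (3 * (K * t)) := by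
          rw [show 3 * (K * t) = 2 * (K * t) + K * t by ring, Real.exp_add]; ring
  have hpow : y ^ r ≤ a ^ r * t ^ r * Real.exp (r * (K * t)) := by
    have hexp : y ≤ a * t * Real.exp (K * t) := hyt.trans (by gcongr)
    refine (pow_le_pow_left₀ hy.le hexp r).trans_eq ?_
    rw [mul_pow, mul_pow, ← Real.exp_nat_mul]
  have har : a ^ r = a ^ (r - 1) * a := by rw [← pow_succ, Nat.sub_add_cancel hr]
  calc V * y ^ r ≤ V * (a ^ r * t ^ r * Real.exp (r * (K * t))) := by gcongr
    _ = a * V * (a ^ (r - 1) * t ^ r * Real.exp (r * (K * t))) := by rw [har]; ring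
    _ ≤ l * W * Real.exp (3 * (K * t)) *
        (a ^ (r - 1) * t ^ r * Real.exp (r * (K * t))) := by gcongr
    _ = l * a ^ (r - 1) * (W * t ^ r * Real.exp ((r + 3) * K * t)) := by
        rw [show (r + 3) * K * t = 3 * (K * t) + r * (K * t) by ring, Real.exp_add]; ring
    _ ≤ W * t ^ r * Real.exp ((r + 3) * K * t) :=
        mul_le_of_le_one_left (by positivity) hla

/-- A positive function `v` with `l v(f x) ≥ a v(x)` to first order along a contraction `f` with
multiplier `a` satisfying `l a ^ (r - 1) ≤ 1` cannot decay faster than `(x - q) ^ r`. -/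
lemma not_isLittleO_pow_of_displacement {q a : ℝ} {l r : ℕ} {f v : ℝ → ℝ} (hl : 0 < l)
    (ha0 : 0 < a) (ha1 : a < 1) (hr : 1 ≤ r) (hla : l * a ^ (r - 1) ≤ 1)
    (hft : Tendsto f (𝓝[>] q) (𝓝[>] q))
    (hf : (fun x => f x - q - a * (x - q)) =O[𝓝[>] q] fun x => (x - q) ^ 2)
    (hv : ∀ᶠ x in 𝓝[>] q, v x ≠ 0)
    (hfv : (fun x => l * v (f x) - a * v x) =O[𝓝[>] q] fun x => (x - q) * (|v x| + |v (f x)|)) :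
    ¬ v =o[𝓝[>] q] fun x => (x - q) ^ r := by
  intro hvo
  have hl' : (0 : ℝ) < l := by exact_mod_cast hl
  obtain ⟨K₁, hK₁, h1⟩ := hf.exists_pos
  obtain ⟨K₂, hK₂, h2⟩ := hfv.exists_pos
  obtain ⟨K, hK, hKa, hKl, hK2⟩ : ∃ K : ℝ, 0 < K ∧ K₁ ≤ a * K ∧ K₂ ≤ l * K ∧ K₂ ≤ a * K := by
    refine ((eventually_gt_atTop 0).and (((tendsto_id.const_mul_atTop ha0).eventually_ge_atTop
      K₁).and (((tendsto_id.const_mul_atTop hl').eventually_ge_atTop K₂).and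
      ((tendsto_id.const_mul_atTop ha0).eventually_ge_atTop K₂)))).exists
  set ρ := (1 + a) / 2 with hρ
  have hρ1 : ρ < 1 := by rw [hρ]; linarith
  have hρ0 : 0 < ρ := by rw [hρ]; linarith
  set M := (r + 3) * K / (1 - ρ) with hM
  have hMρ : M * (1 - ρ) = (r + 3) * K := by
    rw [hM]; field_simp [(sub_pos.2 hρ1).ne']
  have hM0 : 0 ≤ M := div_nonneg (by positivity) (by linarith)
  clear_value M
  have hsmall : ∀ c : ℝ, 0 < c → ∀ᶠ x in 𝓝[>] q, x - q < c := fun c hc => by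
    filter_upwards [Ioo_mem_nhdsGT (show q < q + c by linarith)] with x hx
    linarith [hx.2]
  have hmem : ∀ᶠ x in 𝓝[>] q, q < f x := hft.eventually self_mem_nhdsWithin
  set φ : ℝ → ℝ := fun x => |v x| / (x - q) ^ r * Real.exp (-(M * (x - q))) with hφ
  have hstep : ∀ᶠ x in 𝓝[>] q, q < f x ∧ f x - q ≤ ρ * (x - q) ∧ φ x ≤ φ (f x) := by
    filter_upwards [h1.bound, h2.bound, hmem, self_mem_nhdsWithin,
      hsmall ((1 - a) / 2 / K₁) (by have := sub_pos.2 ha1; positivity),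
      hsmall (1 / (2 * K)) (by positivity)] with x b1 b2 hfx hx c1 c2
    have hx : 0 < x - q := sub_pos.2 hx
    have hfx' : 0 < f x - q := sub_pos.2 hfx
    rw [lt_div_iff₀ hK₁] at c1
    rw [lt_div_iff₀ (by positivity)] at c2
    set t := x - q with ht
    have b1' : f x - q ≤ a * t + K₁ * t ^ 2 := by
      rw [Real.norm_of_nonneg (by positivity : 0 ≤ t ^ 2)] at b1
      linarith [(abs_le.1 b1).2]
    have hρt : f x - q ≤ ρ * t := by
      refine b1'.trans ?_
      rw [hρ]; nlinarith
    refine ⟨hfx, hρt, ?_⟩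
    have hexp : f x - q ≤ a * t * (K * t + 1) := by
      refine b1'.trans ?_
      have : K₁ * t ^ 2 ≤ a * K * t ^ 2 := by gcongr
      linarith
    have hvv : (1 - K * t) * (a * |v x|) ≤ (K * t + 1) * (l * |v (f x)|) := by
      have b3 : ‖t * (|v x| + |v (f x)|)‖ = t * (|v x| + |v (f x)|) :=
        Real.norm_of_nonneg (by positivity)
      rw [b3] at b2
      have b4 : a * |v x| - l * |v (f x)| ≤ K₂ * (t * (|v x| + |v (f x)|)) := by
        refine le_trans ?_ b2
        have := abs_sub_abs_le_abs_sub (a * v x) (l * v (f x))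
        rw [abs_mul, abs_mul, abs_of_pos ha0, abs_of_pos hl', abs_sub_comm] at this
        exact this
      have b5 : K₂ * t * |v x| ≤ a * K * t * |v x| := by gcongr
      have b6 : K₂ * t * |v (f x)| ≤ l * K * t * |v (f x)| := by gcongr
      linarith
    have hmain := mul_pow_le_mul_pow_mul_exp ha0 hK hx hfx' (abs_nonneg (v x))
      (abs_nonneg (v (f x))) hr hla (by linarith) hexp hvv
    have hexpM : Real.exp ((r + 3) * K * t) * Real.exp (-(M * t)) ≤
        Real.exp (-(M * (f x - q))) := by
      rw [← Real.exp_add, Real.exp_le_exp, ← hMρ]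
      nlinarith [mul_le_mul_of_nonneg_left hρt hM0]
    simp only [hφ]
    rw [← ht, div_mul_eq_mul_div, div_mul_eq_mul_div, div_le_div_iff₀ (by positivity) (by positivity)]
    calc |v x| * Real.exp (-(M * t)) * (f x - q) ^ r
        = |v x| * (f x - q) ^ r * Real.exp (-(M * t)) := by ring
      _ ≤ |v (f x)| * t ^ r * Real.exp ((r + 3) * K * t) * Real.exp (-(M * t)) := by gcongr
      _ = |v (f x)| * t ^ r * (Real.exp ((r + 3) * K * t) * Real.exp (-(M * t))) := by ring
      _ ≤ |v (f x)| * t ^ r * Real.exp (-(M * (f x - q))) := by gcongr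
      _ = |v (f x)| * Real.exp (-(M * (f x - q))) * t ^ r := by ring
  obtain ⟨u, hu, hsub⟩ := mem_nhdsGT_iff_exists_Ioo_subset.1 (hstep.and hv)
  obtain ⟨x₀, hx₀⟩ := nonempty_Ioo.2 (show q < u from hu)
  have horbit : ∀ n : ℕ, f^[n] x₀ ∈ Ioo q u ∧ f^[n] x₀ - q ≤ ρ ^ n * (x₀ - q) ∧
      φ x₀ ≤ φ (f^[n] x₀) := fun n => by
    induction n with
    | zero => simpa using hx₀
    | succ n ih =>
      obtain ⟨i1, i2, i3⟩ := ih
      obtain ⟨⟨j1, j2, j3⟩, -⟩ := hsub i1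
      rw [Function.iterate_succ_apply']
      refine ⟨⟨j1, ?_⟩, ?_, i3.trans j3⟩
      · nlinarith [i1.1, i1.2]
      · refine j2.trans ?_
        rw [pow_succ', mul_assoc]
        gcongr
  have hφ0 : 0 < φ x₀ := by
    have h3 : v x₀ ≠ 0 := (hsub hx₀).2
    have h4 := sub_pos.2 hx₀.1
    simp only [hφ]
    positivity
  have hlim : Tendsto (fun n => f^[n] x₀) atTop (𝓝[>] q) := by
    refine tendsto_nhdsWithin_iff.2 ⟨?_, Eventually.of_forall fun n => (horbit n).1.1⟩
    rw [← tendsto_sub_nhds_zero_iff]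
    refine squeeze_zero (fun n => (sub_pos.2 (horbit n).1.1).le) (fun n => (horbit n).2.1) ?_
    simpa using (tendsto_pow_atTop_nhds_zero_of_lt_one hρ0.le hρ1).mul_const (x₀ - q)
  obtain ⟨n, hn⟩ := (hlim.eventually (hvo.bound (half_pos hφ0))).exists
  have h5 := sub_pos.2 (horbit n).1.1
  have h6 : φ (f^[n] x₀) ≤ φ x₀ / 2 := by
    refine le_trans (mul_le_of_le_one_right (by positivity) ?_) ?_
    · rw [Real.exp_le_one_iff]
      nlinarith
    · rw [div_le_iff₀ (by positivity)]
      rwa [Real.norm_of_nonneg (by positivity : 0 ≤ (f^[n] x₀ - q) ^ r)] at hn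
  linarith [(horbit n).2.2]

/-- If the derivatives of `g` at `q` of orders `2, …, n` vanish, `g q = q` and `g' q = 1`, then the
`n`-th Taylor polynomial of `g` at `q` is the identity. -/
lemma taylorWithinEval_eq_self {g : ℝ → ℝ} {s : Set ℝ} {q : ℝ} (hgq : g q = q)
    (hg1 : derivWithin g s q = 1) {n : ℕ} (hn : 1 ≤ n)
    (h : ∀ j, 2 ≤ j → j ≤ n → iteratedDerivWithin j g s q = 0) (x : ℝ) :
    taylorWithinEval g n s q x = x := by
  induction n, hn using Nat.le_induction with
  | base =>
    rw [taylorWithinEval_succ, taylor_within_zero_eval, zero_add, iteratedDerivWithin_one, hg1, hgq]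
    simp
  | succ n hn ih =>
    rw [taylorWithinEval_succ, ih fun j h2 hj => h j h2 (by omega), h (n + 1) (by omega) le_rfl]
    simp

lemma IsCrDiffeoOnIco.hasDerivWithinAt {r : WithTop ℕ∞} {f : ℝ → ℝ} {q q₁ : ℝ}
    (hf : IsCrDiffeoOnIco r f q q₁) (hr : r ≠ 0) (hq : q < q₁) :
    HasDerivWithinAt f (derivWithin f (Ico q q₁) q) (Ico q q₁) q :=
  ((hf.2.1.differentiableOn hr) q (left_mem_Ico.2 hq)).hasDerivWithinAt

lemma IsCrDiffeoOnIco.mapsTo_Ioo {r : WithTop ℕ∞} {f : ℝ → ℝ} {q q₁ : ℝ}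
    (hf : IsCrDiffeoOnIco r f q q₁) (hfq : f q = q) : MapsTo f (Ioo q q₁) (Ioo q q₁) := by
  intro x hx
  have hxS := Ioo_subset_Ico_self hx
  have h := hf.1.mapsTo hxS
  refine ⟨lt_of_le_of_ne h.1 fun he => hx.1.ne ?_, h.2⟩
  exact hf.1.injOn (left_mem_Ico.2 (hx.1.trans hx.2)) hxS (hfq.trans he)

lemma IsCrDiffeoOnIco.tendsto_nhdsGT {r : WithTop ℕ∞} {f : ℝ → ℝ} {q q₁ : ℝ}
    (hf : IsCrDiffeoOnIco r f q q₁) (hq : q < q₁) (hfq : f q = q) :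
    Tendsto f (𝓝[>] q) (𝓝[>] q) := by
  rw [← nhdsWithin_Ioo_eq_nhdsGT hq]
  have h := (hf.2.1.continuousOn q (left_mem_Ico.2 hq)).mono Ioo_subset_Ico_self
  simpa [hfq] using h.tendsto_nhdsWithin (hf.mapsTo_Ioo hfq)

lemma nhdsGT_le_nhdsWithin_Ico {q q₁ : ℝ} (hq : q < q₁) : 𝓝[>] q ≤ 𝓝[Ico q q₁] q := by
  rw [nhdsWithin_Ico_eq_nhdsGE hq]
  exact nhdsWithin_mono q Ioi_subset_Ici_self

lemma IsCrDiffeoOnIco.isBigO_sub {r : WithTop ℕ∞} {f : ℝ → ℝ} {q q₁ : ℝ}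
    (hf : IsCrDiffeoOnIco r f q q₁) (hr : r ≠ 0) (hq : q < q₁) (hfq : f q = q) :
    (fun x => f x - q) =O[𝓝[>] q] fun x => x - q := by
  have h := (hf.hasDerivWithinAt hr hq).isBigO_sub
  rw [prod_pure, isBigO_map] at h
  simpa only [Function.comp_def, hfq] using h.mono (nhdsGT_le_nhdsWithin_Ico hq)

/-- A map with positive multiplier at `q` that is conjugate to its `l`-th iterate by a map with
nonzero multiplier is tangent to the identity. -/
lemma eq_one_of_comp_eq_iterate_comp {f g : ℝ → ℝ} {s : Set ℝ} {q a b : ℝ} {l : ℕ} (hl : 2 ≤ l)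
    (hs : UniqueDiffWithinAt ℝ s q) (hqs : q ∈ s) (hf : HasDerivWithinAt f a s q)
    (hg : HasDerivWithinAt g b s q) (hfs : MapsTo f s s) (hgs : MapsTo g s s) (hfq : f q = q)
    (hgq : g q = q) (ha : a ≠ 0) (hb : 0 < b) (hrel : ∀ x ∈ s, f (g x) = g^[l] (f x)) : b = 1 := by
  have h1 : HasDerivWithinAt (f ∘ g) (a * b) s q :=
    HasDerivWithinAt.comp q (by rwa [hgq]) hg hgs
  have h2 : HasDerivWithinAt (g^[l] ∘ f) (b ^ l * a) s q :=
    HasDerivWithinAt.comp q (by rw [hfq]; exact HasDerivWithinAt.iterate q hg hgq hgs l) hf hfs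
  have h3 : a * b = b ^ l * a := hs.eq_deriv _ h1 (h2.congr hrel (hrel q hqs))
  have h4 : b ^ (l - 1) = 1 := by
    have h5 : b ^ l = b ^ (l - 1) * b := by rw [← pow_succ, Nat.sub_add_cancel (by omega)]
    have h6 : a * b * (b ^ (l - 1) - 1) = 0 := by rw [h5] at h3; linarith
    rcases mul_eq_zero.1 h6 with h | h
    · exact absurd h (mul_ne_zero ha hb.ne')
    · linarith
  exact (pow_eq_one_iff_of_nonneg hb.le (by omega)).1 h4

/-- If `v(x) = A (x - q) ^ k + o((x - q) ^ k)` with `A ≠ 0` and `l v(f x) = a v(x)` to first order,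
where `f` has multiplier `a` at `q`, then `l a ^ k = a`. -/
lemma mul_pow_eq_of_displacement {q a c A : ℝ} {k : ℕ} {f v : ℝ → ℝ} (hA : A ≠ 0)
    (hft : Tendsto f (𝓝[>] q) (𝓝[>] q))
    (hf : (fun x => f x - q - a * (x - q)) =O[𝓝[>] q] fun x => (x - q) ^ 2)
    (hv : (fun x => v x - A * (x - q) ^ k) =o[𝓝[>] q] fun x => (x - q) ^ k)
    (hfv : (fun x => c * v (f x) - a * v x) =O[𝓝[>] q] fun x => (x - q) * (|v x| + |v (f x)|)) :
    c * a ^ k = a := by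
  have ht : Tendsto (fun x => x - q) (𝓝[>] q) (𝓝 0) :=
    tendsto_sub_nhds_zero_iff.2 nhdsWithin_le_nhds
  have hne : ∀ᶠ x in 𝓝[>] q, x - q ≠ 0 := by
    filter_upwards [self_mem_nhdsWithin] with x hx using (sub_pos.2 hx).ne'
  have hpos : ∀ᶠ x in 𝓝[>] q, 0 < x - q := by
    filter_upwards [self_mem_nhdsWithin] with x hx using sub_pos.2 hx
  have hlim_v : Tendsto (fun x => v x / (x - q) ^ k) (𝓝[>] q) (𝓝 A) := by
    have h := hv.tendsto_div_nhds_zero.add_const A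
    rw [zero_add] at h
    refine h.congr' ?_
    filter_upwards [hne] with x hx
    field_simp
    ring
  have hlim_f : Tendsto (fun x => (f x - q) / (x - q)) (𝓝[>] q) (𝓝 a) := by
    have h1 : (fun x : ℝ => (x - q) ^ 2) =o[𝓝[>] q] fun x => x - q := by
      simpa [pow_two] using ((isLittleO_one_iff ℝ).2 ht).mul_isBigO
        (isBigO_refl (fun x => x - q) _)
    have h := (hf.trans_isLittleO h1).tendsto_div_nhds_zero.add_const a
    rw [zero_add] at h
    refine h.congr' ?_
    filter_upwards [hne] with x hx
    field_simp
    ring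
  have hlim_fv : Tendsto (fun x => v (f x) / (x - q) ^ k) (𝓝[>] q) (𝓝 (A * a ^ k)) := by
    refine ((hlim_v.comp hft).mul (hlim_f.pow k)).congr' ?_
    filter_upwards [hne, hft.eventually hne] with x hx hfx
    simp only [Function.comp_apply, div_pow]
    field_simp
  have hlim : Tendsto (fun x => (c * v (f x) - a * v x) / (x - q) ^ k) (𝓝[>] q)
      (𝓝 (c * (A * a ^ k) - a * A)) := by
    refine ((hlim_fv.const_mul c).sub (hlim_v.const_mul a)).congr fun x => ?_
    ring
  have hzero : Tendsto (fun x => (c * v (f x) - a * v x) / (x - q) ^ k) (𝓝[>] q) (𝓝 0) := by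
    have h1 : Tendsto (fun x => (x - q) * (|v x / (x - q) ^ k| + |v (f x) / (x - q) ^ k|))
        (𝓝[>] q) (𝓝 0) := by
      simpa using ht.mul (hlim_v.abs.add hlim_fv.abs)
    refine IsBigO.trans_tendsto ?_ h1
    refine (hfv.mul (isBigO_refl (fun x => ((x - q) ^ k)⁻¹) (𝓝[>] q))).congr' ?_ ?_
    · exact Eventually.of_forall fun x => (div_eq_mul_inv _ _).symm
    · filter_upwards [hpos] with x hx
      rw [abs_div, abs_div, abs_of_pos (pow_pos hx k)]
      ring
  have h := tendsto_nhds_unique hlim hzero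
  have h' : A * (c * a ^ k - a) = 0 := by linarith
  linarith [(mul_eq_zero.1 h').resolve_left hA]

/-- If moreover `f′(q) ≤ (1/λ)^(1/(r-1))`, then `f′(q) = (1/λ)^(1/s)` for some
`1 ≤ s ≤ r-1`, the `(s+1)`-st one-sided derivative of `g` at `q` is nonzero, and in
particular `g` is not `r`-flat at `q`. -/
theorem not_r_flat_at_fixed_point
    (r l : ℕ) (hr : 2 ≤ r) (hl : 2 ≤ l) (q q₁ : ℝ) (hq : q < q₁) (f g : ℝ → ℝ)
    (hf : IsCrDiffeoOnIco r f q q₁) (hg : IsCrDiffeoOnIco r g q q₁)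
    (hfq : f q = q) (hgq : g q = q)
    (hgfix : ∀ x ∈ Set.Ioo q q₁, g x ≠ x)
    (hrel : ∀ x ∈ Set.Ico q q₁, f (g x) = g^[l] (f x))
    (hf'q : derivWithin f (Set.Ico q q₁) q ≤ ((1 : ℝ) / l) ^ ((1 : ℝ) / ((r : ℝ) - 1))) :
    ∃ s : ℕ, 1 ≤ s ∧ s ≤ r - 1 ∧
      derivWithin f (Set.Ico q q₁) q = ((1 : ℝ) / l) ^ ((1 : ℝ) / s) ∧
      iteratedDerivWithin (s + 1) g (Set.Ico q q₁) q ≠ 0 ∧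
      ¬ ((fun x : ℝ => g x - x) =o[nhdsWithin q (Set.Ioi q)] fun x : ℝ => (x - q) ^ r) := by
  have hqS : q ∈ Ico q q₁ := left_mem_Ico.2 hq
  have hr0 : (r : WithTop ℕ∞) ≠ 0 := by exact_mod_cast (by omega : r ≠ 0)
  have hr2 : (2 : WithTop ℕ∞) ≤ r := by exact_mod_cast hr
  have ha0 := hf.2.2 q hqS
  have hfd := hf.hasDerivWithinAt hr0 hq
  have hgd := hg.hasDerivWithinAt hr0 hq
  have hg1 : derivWithin g (Ico q q₁) q = 1 :=
    eq_one_of_comp_eq_iterate_comp hl (uniqueDiffOn_Ico q q₁ q hqS) hqS hfd hgd hf.1.mapsTo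
      hg.1.mapsTo hfq hgq ha0.ne' (hg.2.2 q hqS) hrel
  have hft := hf.tendsto_nhdsGT hq hfq
  have hgt := hg.tendsto_nhdsGT hq hgq
  have hfO := hf.isBigO_sub hr0 hq hfq
  have hgO := hg.isBigO_sub hr0 hq hgq
  have hf2 := isBigO_sub_sub_derivWithin_mul hq (hf.2.1.of_le hr2)
  have hg2 := isBigO_sub_sub_derivWithin_mul hq (hg.2.1.of_le hr2)
  simp only [hg1, one_mul] at hg2
  have hle : 𝓝[>] q ≤ 𝓝[≥] q := nhdsWithin_mono q Ioi_subset_Ici_self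
  set a := derivWithin f (Ico q q₁) q with ha
  have hmem : ∀ᶠ x in 𝓝[>] q, x ∈ Ioo q q₁ := Ioo_mem_nhdsGT hq
  have hdisp : (fun x => l * (g (f x) - f x) - a * (g x - x)) =O[𝓝[>] q]
      fun x => (x - q) * (|g x - x| + |g (f x) - f x|) :=
    isBigO_displacement_comp hft hfO hgt hgO (hf2.mono (prod_mono hle hle))
      (hg2.mono (prod_mono hle hle))
      (hmem.mono fun x hx => hrel x (Ioo_subset_Ico_self hx))
  have hfquad : (fun x => f x - q - a * (x - q)) =O[𝓝[>] q] fun x => (x - q) ^ 2 := by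
    have h := hf2.comp_tendsto ((tendsto_id.mono_left hle).prodMk
      (tendsto_const_pure.mono_right (pure_le_nhdsWithin self_mem_Ici) :
        Tendsto (fun _ : ℝ => q) (𝓝[>] q) (𝓝[≥] q)))
    simp only [Function.comp_def, id, hfq, sub_self, abs_zero, add_zero] at h
    refine h.trans (isBigO_of_le _ fun x => ?_)
    rw [norm_mul, norm_abs_eq_norm, norm_pow, sq]
  have hflat : ¬ (fun x : ℝ => g x - x) =o[𝓝[>] q] fun x : ℝ => (x - q) ^ r := by
    have hl1 : (1 : ℝ) / l < 1 := by
      rw [div_lt_one (by positivity)]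
      exact_mod_cast (by omega : 1 < l)
    have hcast : (r : ℝ) - 1 = (r - 1 : ℕ) := by
      rw [Nat.cast_sub (by omega), Nat.cast_one]
    rw [hcast, one_div ((r - 1 : ℕ) : ℝ)] at hf'q
    refine not_isLittleO_pow_of_displacement (v := fun x => g x - x) (by omega : 0 < l) ha0
      (hf'q.trans_lt (Real.rpow_lt_one (by positivity) hl1 ?_)) (by omega) ?_ hft hfquad
      (hmem.mono fun x hx => sub_ne_zero.2 (hgfix x hx)) hdisp
    · rw [inv_pos, Nat.cast_pos]
      omega
    · have h := pow_le_pow_left₀ ha0.le hf'q (r - 1)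
      rw [Real.rpow_inv_natCast_pow (by positivity) (by omega)] at h
      rwa [le_div_iff₀' (by positivity)] at h
  have hex : ∃ k, 2 ≤ k ∧ k ≤ r ∧ iteratedDerivWithin k g (Ico q q₁) q ≠ 0 := by
    by_contra! hall
    refine hflat ?_
    have h := (taylor_isLittleO (convex_Ico q q₁) hqS hg.2.1).mono (nhdsGT_le_nhdsWithin_Ico hq)
    simpa only [taylorWithinEval_eq_self hgq hg1 (by omega : 1 ≤ r) hall] using h
  classical
  obtain ⟨hk2, hkr, hk⟩ := Nat.find_spec hex
  have hmin : ∀ j, 2 ≤ j → j < Nat.find hex → iteratedDerivWithin j g (Ico q q₁) q = 0 :=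
    fun j hj2 hj => by
      by_contra hne
      exact Nat.find_min hex hj ⟨hj2, by omega, hne⟩
  obtain ⟨s, hs⟩ : ∃ s, Nat.find hex = s + 1 := ⟨Nat.find hex - 1, by omega⟩
  rw [hs] at hk2 hkr hk hmin
  refine ⟨s, by omega, by omega, ?_, hk, hflat⟩
  obtain ⟨A, hA, hgA⟩ : ∃ A : ℝ, A ≠ 0 ∧ (fun x => g x - x - A * (x - q) ^ (s + 1)) =o[𝓝[>] q]
      fun x => (x - q) ^ (s + 1) := by
    refine ⟨((s + 1 : ℝ) * s.factorial)⁻¹ * iteratedDerivWithin (s + 1) g (Ico q q₁) q,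
      mul_ne_zero (by positivity) hk, ?_⟩
    have h := (taylor_isLittleO (n := s + 1) (convex_Ico q q₁) hqS
      (hg.2.1.of_le (by exact_mod_cast hkr))).mono (nhdsGT_le_nhdsWithin_Ico hq)
    refine h.congr_left fun x => ?_
    rw [taylorWithinEval_succ, taylorWithinEval_eq_self hgq hg1 (by omega)
      fun j h2 hj => hmin j h2 (by omega), smul_eq_mul]
    ring
  have hmult : l * a ^ (s + 1) = a :=
    mul_pow_eq_of_displacement hA hft hfquad hgA hdisp
  have has : a ^ s = 1 / l := by
    have hl0 : (l : ℝ) ≠ 0 := by positivity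
    field_simp
    rw [pow_succ, ← mul_assoc] at hmult
    have h := mul_right_cancel₀ ha0.ne' (hmult.trans (one_mul a).symm)
    linarith
  rw [← has, one_div, Real.pow_rpow_inv_natCast ha0.le (by omega)]

end
end

section
/- Let c : [0,∞) → [0,∞) be a C² map with c(0) = 0, c′(x) > 0 for all x ∈ [0,∞), and c(x) < x for all x > 0 (a C² contraction). Let m, n ≥ 1 be integers and define v₁, v₂ : [0,∞) → [0,∞) by v₁(x) = c(x^m)^{1/m} and v₂(x) = c(x^n)^{1/n}, where y^{1/m} denotes the nonnegative real m-th root. Suppose there exists a C¹ diffeomorphism h of [0,∞) (a C¹ bijection of [0,∞) onto itself with C¹ inverse and positive derivative, h(0) = 0) such that h ∘ v₁ = v₂ ∘ h on [0,∞). Then m = n. -/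
open Filter Set Topology

noncomputable section

/-- Positive orbits of a continuous contraction of `[0,∞)` converge to `0`. -/
lemma tendsto_iterate_contraction {c : ℝ → ℝ} (hcont : ContinuousOn c (Ici 0))
    (hpos : ∀ x, 0 < x → 0 < c x) (hcontr : ∀ x, 0 < x → c x < x) {y : ℝ} (hy : 0 < y) :
    Tendsto (fun k => c^[k] y) atTop (𝓝 0) := by
  have hit : ∀ k, 0 < c^[k] y := by
    intro k
    induction k with
    | zero => simpa using hy
    | succ k ih => rw [Function.iterate_succ_apply']; exact hpos _ ih
  have hanti : Antitone (fun k => c^[k] y) := by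
    refine antitone_nat_of_succ_le fun k => ?_
    rw [Function.iterate_succ_apply']
    exact (hcontr _ (hit k)).le
  have hlim := tendsto_atTop_ciInf hanti ⟨0, by rintro _ ⟨k, rfl⟩; exact (hit k).le⟩
  set l := ⨅ k, c^[k] y
  have hl : 0 ≤ l := ge_of_tendsto' hlim fun k => (hit k).le
  have hfix : c l = l := by
    refine tendsto_nhds_unique ?_ ((tendsto_add_atTop_iff_nat 1).2 hlim)
    simp only [Function.iterate_succ_apply']
    exact (hcont l hl).tendsto.comp
      (tendsto_nhdsWithin_iff.2 ⟨hlim, Eventually.of_forall fun k => (hit k).le⟩)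
  rcases hl.eq_or_lt with h0 | h0
  · rwa [← h0] at hlim
  · exact absurd hfix (hcontr l h0).ne

lemma sum_sub_shift_le {u : ℕ → ℝ} (hu : Antitone u) (hpos : ∀ i, 0 ≤ u i) (N k : ℕ) :
    ∑ i ∈ Finset.range k, (u i - u (i + N)) ≤ N * u 0 := by
  induction N with
  | zero => simp
  | succ N ih =>
    have h1 : ∑ i ∈ Finset.range k, (u (i + N) - u (i + 1 + N)) = u (0 + N) - u (k + N) :=
      Finset.sum_range_sub' (fun i => u (i + N)) k
    have h2 : ∑ i ∈ Finset.range k, (u i - u (i + (N + 1))) =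
        ∑ i ∈ Finset.range k, (u i - u (i + N)) +
          ∑ i ∈ Finset.range k, (u (i + N) - u (i + 1 + N)) := by
      rw [← Finset.sum_add_distrib]
      refine Finset.sum_congr rfl fun i _ => ?_
      rw [show i + (N + 1) = i + 1 + N by ring]; ring
    have h3 := hu (Nat.zero_le (0 + N))
    have h4 := hpos (k + N)
    push_cast
    linarith

/-- A Kopell-type lemma: if `g` commutes with a contraction `c` of bounded distortion and the
derivative of `g` tends to `0` at `0`, then this derivative vanishes at every point that `g`
moves to the left. -/
lemma deriv_eq_zero_of_commute_contraction {c c' g g' : ℝ → ℝ} {y L : ℝ}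
    (hcont : ContinuousOn c (Ici 0)) (hmono : MonotoneOn c (Ioi 0))
    (hpos : ∀ x, 0 < x → 0 < c x) (hcontr : ∀ x, 0 < x → c x < x)
    (hc : ∀ x, 0 < x → HasDerivAt c (c' x) x) (hc' : ∀ x, 0 < x → 0 < c' x)
    (hL : 0 ≤ L)
    (hdist : ∀ a b, 0 < b → b ≤ a → a ≤ y → c' a ≤ c' b * Real.exp (L * (a - b)))
    (hgpos : ∀ x, 0 < x → 0 < g x) (hg : ∀ x, 0 < x → HasDerivAt g (g' x) x)
    (hcomm : ∀ x, 0 < x → g (c x) = c (g x)) (hg' : Tendsto g' (𝓝[>] 0) (𝓝 0))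
    (hy : 0 < y) (hgy : g y ≤ y) : g' y = 0 := by
  have hit : ∀ x, 0 < x → ∀ k, 0 < c^[k] x := by
    intro x hx k
    induction k with
    | zero => simpa using hx
    | succ k ih => rw [Function.iterate_succ_apply']; exact hpos _ ih
  have hanti : Antitone (fun k => c^[k] y) := by
    refine antitone_nat_of_succ_le fun k => ?_
    rw [Function.iterate_succ_apply']
    exact (hcontr _ (hit y hy k)).le
  have hle : ∀ a b, 0 < a → a ≤ b → ∀ k, c^[k] a ≤ c^[k] b := by
    intro a b ha hab k
    induction k with
    | zero => simpa using hab
    | succ k ih =>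
      rw [Function.iterate_succ_apply', Function.iterate_succ_apply']
      exact hmono (hit a ha k) (hit b (ha.trans_le hab) k) ih
  have hcommk : ∀ k, g (c^[k] y) = c^[k] (g y) := by
    intro k
    induction k with
    | zero => rfl
    | succ k ih =>
      rw [Function.iterate_succ_apply', Function.iterate_succ_apply', hcomm _ (hit y hy k), ih]
  have hchain : ∀ x, 0 < x → g' (c x) * c' x = c' (g x) * g' x := by
    intro x hx
    have h1 : HasDerivAt (g ∘ c) (g' (c x) * c' x) x := (hg _ (hpos x hx)).comp x (hc x hx)
    have h2 : HasDerivAt (c ∘ g) (c' (g x) * g' x) x := (hc _ (hgpos x hx)).comp x (hg x hx)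
    refine (h1.congr_of_eventuallyEq ?_).unique h2
    filter_upwards [Ioi_mem_nhds hx] with t ht using (hcomm t ht).symm
  have hz := hgpos y hy
  set z := g y with hzdef
  let P : ℕ → ℝ → ℝ := fun k x => ∏ i ∈ Finset.range k, c' (c^[i] x)
  have hP : ∀ x, 0 < x → ∀ k, 0 < P k x := fun x hx k =>
    Finset.prod_pos fun i _ => hc' _ (hit x hx i)
  have hrec : ∀ k, g' y * P k z = g' (c^[k] y) * P k y := by
    intro k
    induction k with
    | zero => simp [P]
    | succ k ih =>
      have h1 := hchain _ (hit y hy k)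
      rw [hcommk k] at h1
      simp only [P, Finset.prod_range_succ, Function.iterate_succ_apply'] at ih ⊢
      linear_combination c' (c^[k] z) * ih - (∏ i ∈ Finset.range k, c' (c^[i] y)) * h1
  obtain ⟨N, hN⟩ : ∃ N, c^[N] y < z :=
    ((tendsto_iterate_contraction hcont hpos hcontr hy).eventually (gt_mem_nhds hz)).exists
  have hdistk : ∀ k, P k y ≤ P k z * Real.exp (L * (N * y)) := by
    intro k
    have h1 : P k y ≤ ∏ i ∈ Finset.range k,
        (c' (c^[i] z) * Real.exp (L * (c^[i] y - c^[i] z))) := by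
      refine Finset.prod_le_prod (fun i _ => (hc' _ (hit y hy i)).le) fun i _ => ?_
      exact hdist _ _ (hit z hz i) (hle z y hz hgy i) (hanti (Nat.zero_le i))
    rw [Finset.prod_mul_distrib, ← Real.exp_sum, ← Finset.mul_sum] at h1
    refine h1.trans (mul_le_mul_of_nonneg_left ?_ (hP z hz k).le)
    refine Real.exp_le_exp.2 (mul_le_mul_of_nonneg_left ?_ hL)
    refine le_trans ?_ (sum_sub_shift_le hanti (fun i => (hit y hy i).le) N k)
    refine Finset.sum_le_sum fun i _ => sub_le_sub_left ?_ _
    rw [Function.iterate_add_apply]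
    exact hle _ _ (hit y hy N) hN.le i
  have hbound : ∀ k, |g' y| ≤ |g' (c^[k] y)| * Real.exp (L * (N * y)) := by
    intro k
    refine le_of_mul_le_mul_right ?_ (hP z hz k)
    calc |g' y| * P k z = |g' (c^[k] y)| * P k y := by
          have := congrArg abs (hrec k)
          rwa [abs_mul, abs_mul, abs_of_pos (hP z hz k), abs_of_pos (hP y hy k)] at this
      _ ≤ |g' (c^[k] y)| * (P k z * Real.exp (L * (N * y))) :=
          mul_le_mul_of_nonneg_left (hdistk k) (abs_nonneg _)
      _ = _ := by ring
  have hlim : Tendsto (fun k => |g' (c^[k] y)| * Real.exp (L * (N * y))) atTop (𝓝 0) := by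
    have h1 : Tendsto (fun k => g' (c^[k] y)) atTop (𝓝 0) :=
      hg'.comp (tendsto_nhdsWithin_iff.2
        ⟨tendsto_iterate_contraction hcont hpos hcontr hy, Eventually.of_forall (hit y hy)⟩)
    simpa using h1.abs.mul_const (Real.exp (L * (N * y)))
  exact abs_nonpos_iff.1 (ge_of_tendsto' hlim hbound)

lemma ContDiffOn.hasDerivAt_derivWithin_Ici {f : ℝ → ℝ} (hf : ContDiffOn ℝ 1 f (Ici 0))
    {x : ℝ} (hx : 0 < x) : HasDerivAt f (derivWithin f (Ici 0) x) x :=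
  (hf.differentiableOn one_ne_zero x hx.le).hasDerivWithinAt.hasDerivAt (Ici_mem_nhds hx)

lemma strictMonoOn_Ici_of_derivWithin_pos {f : ℝ → ℝ} (hf : ContDiffOn ℝ 1 f (Ici 0))
    (hf' : ∀ x ∈ Ici (0 : ℝ), 0 < derivWithin f (Ici 0) x) : StrictMonoOn f (Ici 0) := by
  refine strictMonoOn_of_deriv_pos (convex_Ici 0) hf.continuousOn fun x hx => ?_
  rw [interior_Ici] at hx
  rw [(hf.hasDerivAt_derivWithin_Ici hx).deriv]
  exact hf' x (mem_Ici.2 (mem_Ioi.1 hx).le)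

/-- Bounded distortion of a `C²` map of `[0,∞)` with positive derivative. -/
lemma exists_derivWithin_le_mul_exp {c : ℝ → ℝ} (hc : ContDiffOn ℝ 2 c (Ici 0))
    (hc' : ∀ x ∈ Ici (0 : ℝ), 0 < derivWithin c (Ici 0) x) (y : ℝ) :
    ∃ L, 0 ≤ L ∧ ∀ a b, 0 < b → b ≤ a → a ≤ y →
      derivWithin c (Ici 0) a ≤ derivWithin c (Ici 0) b * Real.exp (L * (a - b)) := by
  have hd : ContDiffOn ℝ 1 (derivWithin c (Ici 0)) (Ici 0) :=
    hc.derivWithin (uniqueDiffOn_Ici 0) (by norm_num)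
  have hl : ContDiffOn ℝ 1 (fun x => Real.log (derivWithin c (Ici 0) x)) (Ici 0) :=
    hd.log fun x hx => (hc' x hx).ne'
  set f := fun x => Real.log (derivWithin c (Ici 0) x) with hf
  obtain ⟨M, hM⟩ := (isCompact_Icc (a := (0 : ℝ)) (b := y)).exists_bound_of_continuousOn
    ((hl.continuousOn_derivWithin (uniqueDiffOn_Ici 0) le_rfl).mono Icc_subset_Ici_self)
  refine ⟨max M 0, le_max_right _ _, fun a b hb hba hay => ?_⟩
  have hb' := hc' b hb.le
  have ha' := hc' a (hb.le.trans hba)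
  have key : ‖f a - f b‖ ≤ max M 0 * ‖a - b‖ := by
    refine (convex_Icc (0 : ℝ) y).norm_image_sub_le_of_norm_hasDerivWithin_le
      (f' := derivWithin f (Ici 0)) (fun x hx => ?_)
      (fun x hx => (hM x hx).trans (le_max_left _ _)) ⟨hb.le, hba.trans hay⟩
      ⟨hb.le.trans hba, hay⟩
    exact (hl.differentiableOn one_ne_zero x hx.1).hasDerivWithinAt.mono Icc_subset_Ici_self
  rw [Real.norm_eq_abs, Real.norm_eq_abs, abs_of_nonneg (sub_nonneg.2 hba)] at key
  have h1 : f a ≤ f b + max M 0 * (a - b) := by linarith [le_abs_self (f a - f b)]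
  calc derivWithin c (Ici 0) a = Real.exp (f a) := (Real.exp_log ha').symm
    _ ≤ Real.exp (f b + max M 0 * (a - b)) := Real.exp_le_exp.2 h1
    _ = _ := by rw [Real.exp_add, hf, Real.exp_log hb']

/-- A `C¹` conjugacy cannot increase the order of ramification. -/
lemma ramification_le_of_conjugate {m n : ℕ} (hm : 1 ≤ m) (hn : 1 ≤ n) {c h : ℝ → ℝ}
    (hcdiff : ContDiffOn ℝ 2 c (Ici 0)) (hc0 : c 0 = 0)
    (hc' : ∀ x ∈ Ici (0 : ℝ), 0 < derivWithin c (Ici 0) x)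
    (hcontr : ∀ x : ℝ, 0 < x → c x < x)
    (hhdiff : ContDiffOn ℝ 1 h (Ici 0))
    (hh' : ∀ x ∈ Ici (0 : ℝ), 0 < derivWithin h (Ici 0) x) (hh0 : h 0 = 0)
    (hconj : ∀ x ∈ Ici (0 : ℝ),
      h ((c (x ^ m)) ^ ((1 : ℝ) / m)) = (c ((h x) ^ n)) ^ ((1 : ℝ) / n)) :
    n ≤ m := by
  by_contra! hmn
  have hm0 : m ≠ 0 := by omega
  have hn0 : n ≠ 0 := by omega
  have hmR : (0 : ℝ) < m := by positivity
  have hc1 : ContDiffOn ℝ 1 c (Ici 0) := hcdiff.of_le (by norm_num)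
  have hcmono := strictMonoOn_Ici_of_derivWithin_pos hc1 hc'
  have hhmono := strictMonoOn_Ici_of_derivWithin_pos hhdiff hh'
  have hcpos : ∀ x, 0 < x → 0 < c x := fun x hx => by
    simpa [hc0] using hcmono (mem_Ici.2 le_rfl) (mem_Ici.2 hx.le) hx
  have hhpos : ∀ x, 0 < x → 0 < h x := fun x hx => by
    simpa [hh0] using hhmono (mem_Ici.2 le_rfl) (mem_Ici.2 hx.le) hx
  set h' := derivWithin h (Ici 0) with hh'def
  obtain ⟨K, hK⟩ := (isCompact_Icc (a := (0 : ℝ)) (b := 1)).exists_bound_of_continuousOn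
    ((hhdiff.continuousOn_derivWithin (uniqueDiffOn_Ici 0) le_rfl).mono Icc_subset_Ici_self)
  have hK0 : 0 ≤ K := (norm_nonneg _).trans (hK 0 ⟨le_rfl, zero_le_one⟩)
  have hhK : ∀ x, 0 < x → x ≤ 1 → h x ≤ K * x := by
    intro x hx hx1
    have := (convex_Icc (0 : ℝ) 1).norm_image_sub_le_of_norm_hasDerivWithin_le
      (f := h) (f' := h') (C := K) (x := 0) (y := x)
      (fun t ht => (hhdiff.differentiableOn one_ne_zero t ht.1).hasDerivWithinAt.mono
        Icc_subset_Ici_self) hK ⟨le_rfl, zero_le_one⟩ ⟨hx.le, hx1⟩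
    rw [hh0, sub_zero, sub_zero, Real.norm_eq_abs, Real.norm_eq_abs, abs_of_pos hx] at this
    exact (le_abs_self _).trans this
  let r : ℝ → ℝ := fun y => y ^ ((1 : ℝ) / m)
  have hrpos : ∀ y, 0 < y → 0 < r y := fun y hy => Real.rpow_pos_of_pos hy _
  have hrpow : ∀ y, 0 < y → r y ^ m = y := fun y hy => by
    simp only [r, one_div]
    exact Real.rpow_inv_natCast_pow hy.le hm0
  have hr1 : ∀ y, 0 < y → y ≤ 1 → r y ≤ 1 := fun y hy hy1 =>
    Real.rpow_le_one hy.le hy1 (by positivity)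
  have hrlim : Tendsto r (𝓝[>] 0) (𝓝 0) := by
    have h1 : ContinuousAt r 0 := Real.continuousAt_rpow_const _ _ (Or.inr (by positivity))
    have h2 : r 0 = 0 := Real.zero_rpow (by positivity)
    have := h1.tendsto.mono_left (nhdsWithin_le_nhds (s := Ioi 0))
    rwa [h2] at this
  let g : ℝ → ℝ := fun y => h (r y) ^ n
  let g' : ℝ → ℝ := fun y =>
    n * h (r y) ^ (n - 1) * (h' (r y) * ((1 : ℝ) / m * y ^ ((1 : ℝ) / m - 1)))
  have hgpos : ∀ y, 0 < y → 0 < g y := fun y hy => pow_pos (hhpos _ (hrpos y hy)) _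
  have hg : ∀ y, 0 < y → HasDerivAt g (g' y) y := by
    intro y hy
    have h1 : HasDerivAt r ((1 : ℝ) / m * y ^ ((1 : ℝ) / m - 1)) y :=
      Real.hasDerivAt_rpow_const (Or.inl hy.ne')
    exact ((hhdiff.hasDerivAt_derivWithin_Ici (hrpos y hy)).comp y h1).pow n
  have hg'pos : ∀ y, 0 < y → 0 < g' y := by
    intro y hy
    have h1 := hhpos _ (hrpos y hy)
    have h2 := hh' _ (hrpos y hy).le
    have h3 := Real.rpow_pos_of_pos hy ((1 : ℝ) / m - 1)
    positivity
  have hcomm : ∀ y, 0 < y → g (c y) = c (g y) := by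
    intro y hy
    have h1 := hconj (r y) (hrpos y hy).le
    rw [hrpow y hy] at h1
    change h (c y ^ ((1 : ℝ) / m)) ^ n = c (h (r y) ^ n)
    rw [h1, one_div]
    exact Real.rpow_inv_natCast_pow (hcpos _ (hgpos y hy)).le hn0
  have hypow : ∀ y, 0 < y → y ^ ((1 : ℝ) / m - 1) * r y ^ (m - 1) = 1 := by
    intro y hy
    simp only [r]
    rw [← Real.rpow_natCast, ← Real.rpow_mul hy.le, ← Real.rpow_add hy, Nat.cast_sub hm]
    have : (1 : ℝ) / m - 1 + 1 / m * ((m : ℝ) - (1 : ℕ)) = 0 := by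
      push_cast; field_simp; ring
    rw [this, Real.rpow_zero]
  have hg'bound : ∀ y, 0 < y → y ≤ 1 → g' y ≤ n * K ^ n / m * r y := by
    intro y hy hy1
    have hx := hrpos y hy
    have hx1 := hr1 y hy hy1
    have h1 := hhK _ hx hx1
    have h2 : h' (r y) ≤ K := (le_abs_self _).trans (hK _ ⟨hx.le, hx1⟩)
    have h3 := Real.rpow_pos_of_pos hy ((1 : ℝ) / m - 1)
    have h4 := hhpos _ hx
    have h5 := hh' _ hx.le
    have h6 : r y ^ (n - 1) ≤ r y ^ m := pow_le_pow_of_le_one hx.le hx1 (by omega)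
    calc g' y ≤ n * (K * r y) ^ (n - 1) * (K * ((1 : ℝ) / m * y ^ ((1 : ℝ) / m - 1))) := by
          simp only [g']; gcongr
      _ = n * (K ^ (n - 1) * K) / m * (y ^ ((1 : ℝ) / m - 1) * r y ^ (n - 1)) := by
          rw [mul_pow]; ring
      _ ≤ n * (K ^ (n - 1) * K) / m * (y ^ ((1 : ℝ) / m - 1) * r y ^ m) := by gcongr
      _ = n * (K ^ (n - 1) * K) / m * (y ^ ((1 : ℝ) / m - 1) * r y ^ (m - 1) * r y) := by
          rw [mul_assoc (y ^ _), pow_sub_one_mul hm0]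
      _ = n * K ^ n / m * r y := by rw [hypow y hy, one_mul, pow_sub_one_mul hn0]
  have hIoc : ∀ᶠ y in 𝓝[>] (0 : ℝ), y ∈ Ioc (0 : ℝ) 1 := Ioc_mem_nhdsGT one_pos
  have hg'lim : Tendsto g' (𝓝[>] 0) (𝓝 0) := by
    refine squeeze_zero' (g := fun y => n * K ^ n / m * r y) ?_ ?_ ?_
    · filter_upwards [hIoc] with y hy using (hg'pos y hy.1).le
    · filter_upwards [hIoc] with y hy using hg'bound y hy.1 hy.2
    · simpa using hrlim.const_mul (n * K ^ n / m : ℝ)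
  obtain ⟨y, hy, hyK⟩ : ∃ y ∈ Ioc (0 : ℝ) 1, K ^ n * r y < 1 := by
    have h1 : Tendsto (fun y => K ^ n * r y) (𝓝[>] 0) (𝓝 0) := by
      simpa using hrlim.const_mul (K ^ n)
    exact (hIoc.and (h1.eventually (gt_mem_nhds one_pos))).exists
  have hgy : g y ≤ y := by
    have hx := hrpos y hy.1
    have hx1 := hr1 y hy.1 hy.2
    calc g y ≤ (K * r y) ^ n := pow_le_pow_left₀ (hhpos _ hx).le (hhK _ hx hx1) n
      _ = K ^ n * r y ^ n := mul_pow _ _ _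
      _ ≤ K ^ n * r y ^ (m + 1) :=
          mul_le_mul_of_nonneg_left (pow_le_pow_of_le_one hx.le hx1 hmn) (by positivity)
      _ = K ^ n * r y * y := by rw [pow_succ, hrpow y hy.1]; ring
      _ ≤ 1 * y := mul_le_mul_of_nonneg_right hyK.le hy.1.le
      _ = y := one_mul y
  obtain ⟨L, hL, hdist⟩ := exists_derivWithin_le_mul_exp hcdiff hc' y
  exact (hg'pos y hy.1).ne' (deriv_eq_zero_of_commute_contraction hcdiff.continuousOn
    (hcmono.monotoneOn.mono Ioi_subset_Ici_self) hcpos hcontr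
    (fun x hx => hc1.hasDerivAt_derivWithin_Ici hx) (fun x hx => hc' x (le_of_lt hx))
    hL hdist hgpos hg hcomm hg'lim hy.1 hgy)

/-- If the maps `v₁(x) = c(x^m)^(1/m)` and `v₂(x) = c(x^n)^(1/n)` built from a `C²`
contraction `c` of `[0,∞)` are conjugate by a `C¹` diffeomorphism of `[0,∞)`,
then `m = n`. -/
theorem conjugate_ramified_contractions_same_order
    (m n : ℕ) (hm : 1 ≤ m) (hn : 1 ≤ n) (c : ℝ → ℝ)
    (hcdiff : ContDiffOn ℝ 2 c (Set.Ici 0)) (hc0 : c 0 = 0)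
    (hc' : ∀ x ∈ Set.Ici (0 : ℝ), 0 < derivWithin c (Set.Ici 0) x)
    (hcontr : ∀ x : ℝ, 0 < x → c x < x)
    (hcmap : Set.MapsTo c (Set.Ici 0) (Set.Ici 0))
    (h : ℝ → ℝ)
    (hhbij : Set.BijOn h (Set.Ici 0) (Set.Ici 0))
    (hhdiff : ContDiffOn ℝ 1 h (Set.Ici 0))
    (hh' : ∀ x ∈ Set.Ici (0 : ℝ), 0 < derivWithin h (Set.Ici 0) x)
    (hh0 : h 0 = 0)
    (hhinv : ∃ hinv : ℝ → ℝ, ContDiffOn ℝ 1 hinv (Set.Ici 0) ∧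
      (∀ x ∈ Set.Ici (0 : ℝ), hinv (h x) = x) ∧ (∀ x ∈ Set.Ici (0 : ℝ), h (hinv x) = x))
    (hconj : ∀ x ∈ Set.Ici (0 : ℝ),
      h ((c (x ^ m)) ^ ((1 : ℝ) / m)) = (c ((h x) ^ n)) ^ ((1 : ℝ) / n)) :
    m = n := by
  have hle := ramification_le_of_conjugate hm hn hcdiff hc0 hc' hcontr hhdiff hh' hh0 hconj
  obtain ⟨k, hkdiff, hkh, hhk⟩ := hhinv
  have hk0 : k 0 = 0 := by simpa [hh0] using hkh 0 (mem_Ici.2 le_rfl)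
  have hkmap : ∀ y ∈ Ici (0 : ℝ), k y ∈ Ici (0 : ℝ) := by
    intro y hy
    obtain ⟨x, hx, rfl⟩ := hhbij.surjOn hy
    rwa [hkh x hx]
  have hk' : ∀ y ∈ Ici (0 : ℝ), 0 < derivWithin k (Ici 0) y := by
    intro y hy
    obtain ⟨x, hx, rfl⟩ := hhbij.surjOn hy
    have h1 := (hkdiff.differentiableOn one_ne_zero _ hy).hasDerivWithinAt.comp x
      (hhdiff.differentiableOn one_ne_zero x hx).hasDerivWithinAt hhbij.mapsTo
    have h2 : HasDerivWithinAt (k ∘ h) 1 (Ici 0) x :=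
      (hasDerivWithinAt_id x (Ici 0)).congr_of_mem (fun t ht => hkh t ht) hx
    have h3 := (uniqueDiffOn_Ici (0 : ℝ) x hx).eq_deriv _ h1 h2
    exact pos_of_mul_pos_left (h3 ▸ one_pos) (hh' x hx).le
  refine le_antisymm ?_ hle
  refine ramification_le_of_conjugate hn hm hcdiff hc0 hc' hcontr hkdiff hk' hk0 fun y hy => ?_
  have h1 := hconj (k y) (hkmap y hy)
  rw [hhk y hy] at h1
  rw [← h1]
  exact hkh _ (Real.rpow_nonneg (hcmap (mem_Ici.2 (pow_nonneg (hkmap y hy) m))) _)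

end
end

section
/- Let n ≥ 2 be an integer and let f, g be C² diffeomorphisms of [0,∞) (C² bijections of [0,∞) onto itself with C² inverse and positive derivative) with f(0) = 0, g(0) = 0, f′(0) > 1, f having no fixed point in (0,∞), and f ∘ g = g^[n] ∘ f on [0,∞). Then g is the identity map of [0,∞). -/
open Filter Set Topology

noncomputable section

/-- A `C²` function on `[0,∞)` is strictly differentiable at `0` within `[0,∞)`. -/
lemma exists_abs_sub_sub_derivWithin_mul_le {φ : ℝ → ℝ} (hφ : ContDiffOn ℝ 2 φ (Ici 0))
    {ε : ℝ} (hε : 0 < ε) :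
    ∃ δ > 0, ∀ u ∈ Icc 0 δ, ∀ v ∈ Icc 0 δ,
      |φ u - φ v - derivWithin φ (Ici 0) 0 * (u - v)| ≤ ε * |u - v| := by
  have hc : ContinuousOn (derivWithin φ (Ici 0)) (Ici 0) :=
    hφ.continuousOn_derivWithin (uniqueDiffOn_Ici 0) (by norm_num)
  obtain ⟨δ, hδ, h⟩ := Metric.continuousWithinAt_iff.1 (hc 0 self_mem_Ici) ε hε
  refine ⟨δ / 2, by positivity, fun u hu v hv => ?_⟩
  have hd : ∀ x ∈ Icc 0 (δ / 2),
      HasDerivWithinAt (fun x => φ x - derivWithin φ (Ici 0) 0 * x)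
        (derivWithin φ (Ici 0) x - derivWithin φ (Ici 0) 0) (Icc 0 (δ / 2)) x := by
    intro x hx
    have h1 : HasDerivWithinAt φ (derivWithin φ (Ici 0) x) (Ici 0) x :=
      (hφ.differentiableOn (by norm_num) x hx.1).hasDerivWithinAt
    have h2 := (h1.mono (show Icc 0 (δ / 2) ⊆ Ici 0 from Icc_subset_Ici_self)).sub
      ((hasDerivWithinAt_id x _).const_mul (derivWithin φ (Ici 0) 0))
    rw [mul_one] at h2
    exact h2
  have hb : ∀ x ∈ Icc 0 (δ / 2),
      ‖derivWithin φ (Ici 0) x - derivWithin φ (Ici 0) 0‖ ≤ ε := by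
    intro x hx
    have hx' : dist x 0 < δ := by
      rw [Real.dist_eq, sub_zero, abs_of_nonneg hx.1]
      linarith [hx.2]
    rw [← dist_eq_norm]
    exact (h hx.1 hx').le
  have := (convex_Icc (0 : ℝ) (δ / 2)).norm_image_sub_le_of_norm_hasDerivWithin_le hd hb hv hu
  simp only [Real.norm_eq_abs] at this
  convert this using 2
  ring

lemma strictMonoOn_Ici_of_derivWithin_pos_s11 {φ : ℝ → ℝ} (hφ : ContinuousOn φ (Ici 0))
    (hφ' : ∀ x ∈ Ici (0 : ℝ), 0 < derivWithin φ (Ici 0) x) : StrictMonoOn φ (Ici 0) := by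
  refine strictMonoOn_of_deriv_pos (convex_Ici 0) hφ fun x hx => ?_
  rw [interior_Ici] at hx
  rw [← derivWithin_of_mem_nhds (Ici_mem_nhds hx)]
  exact hφ' x (mem_Ioi.1 hx).le

lemma derivWithin_zero_eq_one_of_conj {n : ℕ} (hn : 2 ≤ n) {f g : ℝ → ℝ}
    (hf : DifferentiableWithinAt ℝ f (Ici 0) 0) (hg : DifferentiableWithinAt ℝ g (Ici 0) 0)
    (hfm : MapsTo f (Ici 0) (Ici 0)) (hgm : MapsTo g (Ici 0) (Ici 0))
    (hf0 : f 0 = 0) (hg0 : g 0 = 0)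
    (hf' : 0 < derivWithin f (Ici 0) 0) (hg' : 0 < derivWithin g (Ici 0) 0)
    (hrel : ∀ x ∈ Ici (0 : ℝ), f (g x) = g^[n] (f x)) :
    derivWithin g (Ici 0) 0 = 1 := by
  have hF := hf.hasDerivWithinAt
  have hG := hg.hasDerivWithinAt
  have h1 : HasDerivWithinAt (f ∘ g) (derivWithin f (Ici 0) 0 * derivWithin g (Ici 0) 0)
      (Ici 0) 0 := HasDerivWithinAt.comp 0 (by rwa [hg0]) hG hgm
  have h2 : HasDerivWithinAt (g^[n] ∘ f)
      (derivWithin g (Ici 0) 0 ^ n * derivWithin f (Ici 0) 0) (Ici 0) 0 :=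
    HasDerivWithinAt.comp 0 (by rw [hf0]; exact hG.iterate 0 hg0 hgm n) hF hfm
  have h3 := UniqueDiffWithinAt.eq_deriv (Ici (0 : ℝ)) (uniqueDiffOn_Ici 0 0 self_mem_Ici) h1
    (h2.congr (fun x hx => hrel x hx) (hrel 0 self_mem_Ici))
  have h4 : derivWithin g (Ici 0) 0 ^ (n - 1) = 1 := by
    have h5 : derivWithin g (Ici 0) 0 ^ n
        = derivWithin g (Ici 0) 0 ^ (n - 1) * derivWithin g (Ici 0) 0 := by
      rw [← pow_succ]; congr 1; omega
    rw [h5] at h3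
    have h6 : derivWithin f (Ici 0) 0 * derivWithin g (Ici 0) 0 ≠ 0 := by positivity
    refine mul_right_cancel₀ h6 ?_
    linarith
  exact (pow_eq_one_iff_of_nonneg hg'.le (by omega)).1 h4

lemma le_iterate_of_strictMonoOn {g : ℝ → ℝ} {s : Set ℝ} (hg : StrictMonoOn g s)
    (hm : MapsTo g s s) {x : ℝ} (hx : x ∈ s) (h : x < g x) :
    ∀ k : ℕ, g (g x) ≤ g^[k + 2] x := by
  have hi : ∀ k, g^[k] x ∈ s := fun k => hm.iterate k hx
  have hs : ∀ k, g^[k] x < g^[k + 1] x := by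
    intro k
    induction k with
    | zero => exact h
    | succ k ih =>
      rw [Function.iterate_succ_apply', Function.iterate_succ_apply' g (k + 1)]
      exact hg (hi k) (hi (k + 1)) ih
  intro k
  induction k with
  | zero => exact le_rfl
  | succ k ih => exact ih.trans (hs (k + 2)).le

lemma iterate_le_of_strictMonoOn {g : ℝ → ℝ} {s : Set ℝ} (hg : StrictMonoOn g s)
    (hm : MapsTo g s s) {x : ℝ} (hx : x ∈ s) (h : g x < x) :
    ∀ k : ℕ, g^[k + 2] x ≤ g (g x) := by
  have hi : ∀ k, g^[k] x ∈ s := fun k => hm.iterate k hx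
  have hs : ∀ k, g^[k + 1] x < g^[k] x := by
    intro k
    induction k with
    | zero => exact h
    | succ k ih =>
      have := hg (hi (k + 1)) (hi k) ih
      rwa [← Function.iterate_succ_apply' g, ← Function.iterate_succ_apply' g] at this
  intro k
  induction k with
  | zero => exact le_rfl
  | succ k ih => exact (hs (k + 2)).le.trans ih

/-- For an increasing map, the displacement of `g^[n]` dominates the sum of the first two
successive displacements. -/
lemma abs_add_abs_le_abs_iterate_sub {g : ℝ → ℝ} {s : Set ℝ} (hg : StrictMonoOn g s)
    (hm : MapsTo g s s) {n : ℕ} (hn : 2 ≤ n) {x : ℝ} (hx : x ∈ s) :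
    |g (g x) - g x| + |g x - x| ≤ |g^[n] x - x| := by
  obtain ⟨k, rfl⟩ := Nat.exists_eq_add_of_le' hn
  rcases lt_trichotomy x (g x) with h | h | h
  · have h1 := le_iterate_of_strictMonoOn hg hm hx h k
    have h2 := hg hx (hm hx) h
    rw [abs_of_pos (by linarith), abs_of_pos (by linarith), abs_of_pos (by linarith)]
    linarith
  · simp [← h]
  · have h1 := iterate_le_of_strictMonoOn hg hm hx h k
    have h2 := hg (hm hx) hx h
    rw [abs_of_neg (by linarith), abs_of_neg (by linarith), abs_of_neg (by linarith)]
    linarith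

lemma lt_of_one_lt_derivWithin_zero {f : ℝ → ℝ} (hf : ContDiffOn ℝ 2 f (Ici 0)) (hf0 : f 0 = 0)
    (hf' : 1 < derivWithin f (Ici 0) 0) (hfix : ∀ x : ℝ, 0 < x → f x ≠ x) {x : ℝ} (hx : 0 < x) :
    x < f x := by
  obtain ⟨δ, hδ, h⟩ := exists_abs_sub_sub_derivWithin_mul_le hf
    (show 0 < (derivWithin f (Ici 0) 0 - 1) / 2 by linarith)
  by_contra! hle
  set y := min δ x with hy
  have hy0 : 0 < y := lt_min hδ hx
  have h1 := h y ⟨hy0.le, min_le_left _ _⟩ 0 ⟨le_rfl, hδ.le⟩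
  rw [hf0, sub_zero, sub_zero, abs_of_pos hy0] at h1
  have h2 : y < f y := by
    nlinarith [(abs_le.1 h1).1, mul_pos hy0 (sub_pos.2 hf')]
  have hyx : y ≤ x := min_le_right _ _
  have hcont : ContinuousOn (fun z => f z - z) (Icc y x) :=
    (hf.continuousOn.mono fun z hz => hy0.le.trans hz.1).sub continuousOn_id
  obtain ⟨z, hz, hz0⟩ := intermediate_value_Icc' hyx hcont
    (show (0 : ℝ) ∈ Icc (f x - x) (f y - y) from ⟨by linarith, by linarith⟩)
  exact hfix z (hy0.trans_le hz.1) (sub_eq_zero.1 hz0)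

/-- The relation `f ∘ g = g^[n] ∘ f` with `f` expanding at `0` forces the relative displacement
`|g x - x| / x` to grow under `f⁻¹`, so `g` is the identity near `0`. -/
lemma eq_self_near_zero_of_conj {n : ℕ} (hn : 2 ≤ n) {f g : ℝ → ℝ}
    (hfdiff : ContDiffOn ℝ 2 f (Ici 0)) (hgdiff : ContDiffOn ℝ 2 g (Ici 0))
    (hfs : SurjOn f (Ici 0) (Ici 0)) (hgm : MapsTo g (Ici 0) (Ici 0))
    (hg : StrictMonoOn g (Ici 0)) (hf0 : f 0 = 0) (hg0 : g 0 = 0)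
    (hf' : 0 < derivWithin f (Ici 0) 0) (hg' : derivWithin g (Ici 0) 0 = 1)
    (hlt : ∀ x, 0 < x → x < f x)
    (hrel : ∀ x ∈ Ici (0 : ℝ), f (g x) = g^[n] (f x)) :
    ∃ δ > 0, ∀ x ∈ Ioc 0 δ, g x = x := by
  set l := derivWithin f (Ici 0) 0
  obtain ⟨a, ha, hfa⟩ := exists_abs_sub_sub_derivWithin_mul_le hfdiff
    (show 0 < l / 8 by positivity)
  obtain ⟨b, hb, hgb⟩ := exists_abs_sub_sub_derivWithin_mul_le hgdiff
    (show (0 : ℝ) < 1 / 8 by norm_num)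
  rw [hg'] at hgb
  obtain ⟨δ, hδ, hδa, hδb⟩ : ∃ δ > 0, 2 * δ ≤ a ∧ 2 * δ ≤ b :=
    ⟨min a b / 2, by positivity, by linarith [min_le_left a b], by linarith [min_le_right a b]⟩
  have base : ∀ x ∈ Ioc 0 δ, |g x - x| ≤ 1 / 8 * x := by
    intro x hx
    have := hgb x ⟨hx.1.le, by linarith [hx.1, hx.2]⟩ 0 ⟨le_rfl, hb.le⟩
    simpa [hg0, abs_of_pos hx.1] using this
  have small : ∀ x ∈ Ioc 0 δ, 0 ≤ g x ∧ g x ≤ 2 * δ := by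
    intro x hx
    have := abs_le.1 (base x hx)
    exact ⟨hgm hx.1.le, by linarith [hx.1, hx.2]⟩
  have step : ∀ C : ℝ, (∀ x ∈ Ioc 0 δ, |g x - x| ≤ C * x) →
      ∀ x ∈ Ioc 0 δ, |g x - x| ≤ 3 / 4 * C * x := by
    intro C hC x hx
    obtain ⟨y, hy, hyx⟩ := hfs hx.1.le
    have hy0 : 0 < y := lt_of_le_of_ne hy fun h => by
      rw [← h, hf0] at hyx
      exact hx.1.ne hyx
    have hyδ : y ∈ Ioc 0 δ := ⟨hy0, by linarith [hlt y hy0, hx.2]⟩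
    have h1 := abs_add_abs_le_abs_iterate_sub hg hgm hn (x := x) hx.1.le
    have h2 := hgb (g x) ⟨(small x hx).1, (small x hx).2.trans hδb⟩ x
      ⟨hx.1.le, by linarith [hx.1, hx.2]⟩
    have h3 := hfa (g y) ⟨(small y hyδ).1, (small y hyδ).2.trans hδa⟩ y
      ⟨hy0.le, by linarith [hyδ.1, hyδ.2]⟩
    have h4 := hfa y ⟨hy0.le, by linarith [hyδ.1, hyδ.2]⟩ 0 ⟨le_rfl, ha.le⟩
    rw [hrel y hy, hyx] at h3
    rw [hyx, hf0, sub_zero, sub_zero, abs_of_pos hy0] at h4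
    have h5 : |g x - x| ≤ |g (g x) - g x| + 1 / 8 * |g x - x| := by
      have h6 := abs_sub_abs_le_abs_sub (g x - x) (g (g x) - g x)
      rw [abs_sub_comm (g x - x) (g (g x) - g x)] at h6
      rw [one_mul] at h2
      linarith
    have h7 : |g^[n] x - x| ≤ 9 / 8 * (l * |g y - y|) := by
      have h8 := abs_sub_abs_le_abs_sub (g^[n] x - x) (l * (g y - y))
      rw [abs_mul l, abs_of_pos hf'] at h8
      linarith
    have h9 : 7 / 8 * (l * y) ≤ x := by linarith [(abs_le.1 h4).1]
    have h10 : l * |g y - y| ≤ l * (C * y) := mul_le_mul_of_nonneg_left (hC y hyδ) hf'.le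
    have hC0 : 0 ≤ C := by
      by_contra! hneg
      nlinarith [hC x hx, abs_nonneg (g x - x), hx.1]
    have h11 := mul_le_mul_of_nonneg_left h9 hC0
    have h12 := mul_nonneg hC0 hx.1.le
    nlinarith
  have hall : ∀ k : ℕ, ∀ x ∈ Ioc 0 δ, |g x - x| ≤ (3 / 4 : ℝ) ^ k * (1 / 8) * x := by
    intro k
    induction k with
    | zero => simpa using base
    | succ k ih =>
      intro x hx
      refine (step _ ih x hx).trans_eq ?_
      ring
  refine ⟨δ, hδ, fun x hx => ?_⟩
  have hlim : Tendsto (fun k : ℕ => (3 / 4 : ℝ) ^ k * (1 / 8) * x) atTop (𝓝 0) := by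
    have := ((tendsto_pow_atTop_nhds_zero_of_lt_one (by norm_num : (0 : ℝ) ≤ 3 / 4)
      (by norm_num)).mul_const (1 / 8)).mul_const x
    rwa [zero_mul, zero_mul] at this
  have h0 : |g x - x| ≤ 0 := ge_of_tendsto' hlim fun k => hall k x hx
  exact sub_eq_zero.1 (abs_nonpos_iff.1 h0)

/-- If `f, g` are `C²` diffeomorphisms of `[0,∞)` fixing `0` with `f′(0) > 1`, `f` has no
fixed point in `(0,∞)`, and `f ∘ g = g^[n] ∘ f`, then `g` is the identity. -/
theorem expanding_fixed_point_forces_identity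
    (n : ℕ) (hn : 2 ≤ n) (f g : ℝ → ℝ)
    (hfbij : Set.BijOn f (Set.Ici 0) (Set.Ici 0))
    (hfdiff : ContDiffOn ℝ 2 f (Set.Ici 0))
    (hf' : ∀ x ∈ Set.Ici (0 : ℝ), 0 < derivWithin f (Set.Ici 0) x)
    (hfinv : ∃ finv : ℝ → ℝ, ContDiffOn ℝ 2 finv (Set.Ici 0) ∧
      (∀ x ∈ Set.Ici (0 : ℝ), finv (f x) = x) ∧ (∀ x ∈ Set.Ici (0 : ℝ), f (finv x) = x))
    (hf0 : f 0 = 0)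
    (hgbij : Set.BijOn g (Set.Ici 0) (Set.Ici 0))
    (hgdiff : ContDiffOn ℝ 2 g (Set.Ici 0))
    (hg' : ∀ x ∈ Set.Ici (0 : ℝ), 0 < derivWithin g (Set.Ici 0) x)
    (hginv : ∃ ginv : ℝ → ℝ, ContDiffOn ℝ 2 ginv (Set.Ici 0) ∧
      (∀ x ∈ Set.Ici (0 : ℝ), ginv (g x) = x) ∧ (∀ x ∈ Set.Ici (0 : ℝ), g (ginv x) = x))
    (hg0 : g 0 = 0)
    (hf'0 : 1 < derivWithin f (Set.Ici 0) 0)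
    (hffix : ∀ x : ℝ, 0 < x → f x ≠ x)
    (hrel : ∀ x ∈ Set.Ici (0 : ℝ), f (g x) = g^[n] (f x)) :
    ∀ x ∈ Set.Ici (0 : ℝ), g x = x := by
  have hf := strictMonoOn_Ici_of_derivWithin_pos_s11 hfdiff.continuousOn hf'
  have hg := strictMonoOn_Ici_of_derivWithin_pos_s11 hgdiff.continuousOn hg'
  have hlt : ∀ x, 0 < x → x < f x := fun x hx =>
    lt_of_one_lt_derivWithin_zero hfdiff hf0 hf'0 hffix hx
  have hg1 : derivWithin g (Ici 0) 0 = 1 :=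
    derivWithin_zero_eq_one_of_conj hn (hfdiff.differentiableOn (by norm_num) 0 self_mem_Ici)
      (hgdiff.differentiableOn (by norm_num) 0 self_mem_Ici) hfbij.mapsTo hgbij.mapsTo hf0 hg0
      (hf' 0 self_mem_Ici) (hg' 0 self_mem_Ici) hrel
  obtain ⟨δ, hδ, hid⟩ := eq_self_near_zero_of_conj hn hfdiff hgdiff hfbij.surjOn hgbij.mapsTo hg
    hf0 hg0 (hf' 0 self_mem_Ici) hg1 hlt hrel
  have hinv : ∀ y ∈ Ici (0 : ℝ), g y = y → g (f y) = f y := by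
    intro y hy h
    have h1 := abs_add_abs_le_abs_iterate_sub hg hgbij.mapsTo hn (hfbij.mapsTo hy)
    rw [← hrel y hy, h, sub_self, abs_zero] at h1
    refine sub_eq_zero.1 (abs_nonpos_iff.1 ?_)
    linarith [abs_nonneg (g (g (f y)) - g (f y))]
  by_contra! hne
  set A := {x : ℝ | 0 ≤ x ∧ g x ≠ x}
  have hA : A.Nonempty := hne
  have hAδ : ∀ x ∈ A, δ ≤ x := by
    intro x hx
    by_contra! h
    rcases hx.1.eq_or_lt with h0 | h0
    · exact hx.2 (by rw [← h0, hg0])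
    · exact hx.2 (hid x ⟨h0, h.le⟩)
  have hc : 0 < sInf A := hδ.trans_le (le_csInf hA hAδ)
  obtain ⟨x, hxA, hx⟩ := exists_lt_of_csInf_lt hA (hlt _ hc)
  obtain ⟨y, hy, rfl⟩ := hfbij.surjOn hxA.1
  have hyc : y < sInf A := (hf.lt_iff_lt hy hc.le).1 hx
  exact notMem_of_lt_csInf hyc ⟨δ, hAδ⟩ ⟨hy, fun h => hxA.2 (hinv y hy h)⟩

end
end

section
/- Fix an integer n ≥ 2. Let F, G : ℝ → ℝ be continuous strictly increasing bijections satisfying F(x+1) = F(x)+1 and G(x+1) = G(x)+1 for all x (lifts of orientation-preserving circle homeomorphisms), and suppose there is an integer m with F ∘ G = G^[n] ∘ F + m (i.e. F(G(x)) = G^[n](F(x)) + m for all x), where G^[n] is the n-fold iterate of G. Then (n−1)·τ(G) = −m, where τ(G) is the translation number of G; in particular the translation number of G is rational. -/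
open Filter Set Topology

noncomputable section

/-- If lifts `F, G` of orientation-preserving circle homeomorphisms satisfy
`F ∘ G = G^[n] ∘ F + m`, then the translation number `τ(G)` exists and satisfies
`(n-1)·τ(G) = -m`; in particular it is rational. -/
theorem rotation_number_of_b_is_rational
    (n : ℕ) (hn : 2 ≤ n) (F G : ℝ → ℝ)
    (hFc : Continuous F) (hGc : Continuous G)
    (hFmono : StrictMono F) (hGmono : StrictMono G)
    (hFbij : Function.Bijective F) (hGbij : Function.Bijective G)
    (hFper : ∀ x : ℝ, F (x + 1) = F x + 1) (hGper : ∀ x : ℝ, G (x + 1) = G x + 1)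
    (m : ℤ) (hrel : ∀ x : ℝ, F (G x) = G^[n] (F x) + m) :
    ∃ τ : ℝ, Tendsto (fun k : ℕ => G^[k] 0 / (k : ℝ)) atTop (nhds τ) ∧
      ((n : ℝ) - 1) * τ = -(m : ℝ) ∧ ∃ r : ℚ, τ = (r : ℝ) := by
  let f : CircleDeg1Lift := ⟨⟨F, hFmono.monotone⟩, hFper⟩
  let g : CircleDeg1Lift := ⟨⟨G, hGmono.monotone⟩, hGper⟩
  let t : CircleDeg1Lift := CircleDeg1Lift.translate (Multiplicative.ofAdd (m : ℝ))
  have hsemi : Function.Semiconj f g (t * g ^ n : CircleDeg1Lift) := fun x => by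
    rw [CircleDeg1Lift.mul_apply, CircleDeg1Lift.translate_apply, CircleDeg1Lift.coe_pow, add_comm]
    exact hrel x
  have hcomm : Commute t (g ^ n) :=
    CircleDeg1Lift.ext fun x => by
      simp only [t, CircleDeg1Lift.mul_apply, CircleDeg1Lift.translate_apply,
        CircleDeg1Lift.map_int_add]
  have hτ : g.translationNumber = m + n * g.translationNumber := by
    conv_lhs => rw [CircleDeg1Lift.translationNumber_eq_of_semiconj hsemi,
      CircleDeg1Lift.translationNumber_mul_of_commute hcomm,
      CircleDeg1Lift.translationNumber_translate, CircleDeg1Lift.translationNumber_pow]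
  have hn' : (n : ℝ) - 1 ≠ 0 := by
    have : (2 : ℝ) ≤ n := by exact_mod_cast hn
    linarith
  have hmul : ((n : ℝ) - 1) * g.translationNumber = -(m : ℝ) := by linarith
  refine ⟨g.translationNumber, ?_, hmul, -(m : ℚ) / ((n : ℚ) - 1), ?_⟩
  · have h := g.tendsto_translation_number₀
    simp only [CircleDeg1Lift.coe_pow] at h
    exact h
  · push_cast
    rw [eq_div_iff hn', mul_comm, hmul]

end
end

section
/- Let s ≥ 1 be an odd integer and let f : ℝ → ℝ be a strictly increasing C^∞ diffeomorphism of ℝ with f(0) = 0. Define f̂ : ℝ → ℝ by f̂(x) = sgn(f(x^s))·|f(x^s)|^{1/s} (the real s-th root of f(x^s), well defined since s is odd). Then f̂ is a strictly increasing C^∞ diffeomorphism of ℝ with f̂(0) = 0 and f̂(x)^s = f(x^s) for all x ∈ ℝ; moreover, if f is real-analytic then f̂ is real-analytic. -/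
open Filter Set Topology
open scoped ContDiff

noncomputable section

theorem hasDerivAt_integral_pow_mul_comp_mul {g : ℝ → ℝ} (hg : ContDiff ℝ 1 g) (k : ℕ) (y : ℝ) :
    HasDerivAt (fun y ↦ ∫ t in (0 : ℝ)..1, t ^ k * g (t * y))
      (∫ t in (0 : ℝ)..1, t ^ (k + 1) * deriv g (t * y)) y := by
  have hgc : Continuous g := hg.continuous
  have hdc : Continuous (deriv g) := hg.continuous_deriv le_rfl
  obtain ⟨C, hC⟩ := ((isCompact_Icc (a := (0 : ℝ)) (b := 1)).prod
      (isCompact_closedBall y 1)).exists_bound_of_continuousOn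
    (f := fun p : ℝ × ℝ ↦ p.1 ^ (k + 1) * deriv g (p.1 * p.2)) (by fun_prop)
  refine (intervalIntegral.hasDerivAt_integral_of_dominated_loc_of_deriv_le
    (F' := fun y t ↦ t ^ (k + 1) * deriv g (t * y)) (bound := fun _ ↦ C)
    (Metric.closedBall_mem_nhds y one_pos) (Eventually.of_forall fun x ↦ ?_) ?_ ?_
    (Eventually.of_forall fun t ht x hx ↦ ?_) (by simp)
    (Eventually.of_forall fun t _ x _ ↦ ?_)).2
  · exact (by fun_prop : Continuous fun t ↦ t ^ k * g (t * x)).aestronglyMeasurable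
  · exact (by fun_prop : Continuous fun t ↦ t ^ k * g (t * y)).intervalIntegrable _ _
  · exact (by fun_prop : Continuous fun t ↦ t ^ (k + 1) * deriv g (t * y)).aestronglyMeasurable
  · rw [uIoc_of_le zero_le_one] at ht
    exact hC (t, x) ⟨Ioc_subset_Icc_self ht, hx⟩
  · have h₁ : HasDerivAt (fun x ↦ t * x) t x := by simpa using (hasDerivAt_id x).const_mul t
    have h₂ := ((hg.differentiable one_ne_zero) (t * x)).hasDerivAt.comp x h₁
    exact (h₂.const_mul (t ^ k)).congr_deriv (by ring)

theorem contDiff_integral_pow_mul_comp_mul {g : ℝ → ℝ} {n : ℕ} (hg : ContDiff ℝ n g) (k : ℕ) :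
    ContDiff ℝ n (fun y ↦ ∫ t in (0 : ℝ)..1, t ^ k * g (t * y)) := by
  induction n generalizing g k with
  | zero =>
    have hgc : Continuous g := hg.continuous
    exact contDiff_zero.2 (intervalIntegral.continuous_parametric_intervalIntegral_of_continuous'
      (by unfold Function.uncurry; fun_prop) 0 1)
  | succ n ih =>
    have hd := hasDerivAt_integral_pow_mul_comp_mul (hg.of_le (by norm_cast; omega)) k
    push_cast at hg ⊢
    refine contDiff_succ_iff_deriv.2 ⟨fun y ↦ (hd y).differentiableAt, by simp, ?_⟩
    rw [funext fun y ↦ (hd y).deriv]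
    exact ih (contDiff_succ_iff_deriv.1 hg).2.2 (k + 1)

theorem dslope_zero_eq_integral_deriv {f : ℝ → ℝ} (hf : ContDiff ℝ 1 f) (y : ℝ) :
    dslope f 0 y = ∫ t in (0 : ℝ)..1, deriv f (t * y) := by
  rcases eq_or_ne y 0 with rfl | hy
  · simp
  · have h := intervalIntegral.smul_integral_comp_mul_right (a := 0) (b := 1) (deriv f) y
    rw [intervalIntegral.integral_deriv_eq_sub
      (fun x _ ↦ hf.differentiable one_ne_zero x)
      ((hf.continuous_deriv le_rfl).intervalIntegrable _ _)] at h
    rw [dslope_of_ne _ hy, slope_def_field, div_eq_iff (sub_ne_zero.2 hy)]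
    simp only [smul_eq_mul, zero_mul, one_mul] at h
    rw [← h]; ring

/-- Hadamard's lemma in one variable. -/
theorem contDiff_dslope_zero {f : ℝ → ℝ} (hf : ContDiff ℝ ∞ f) : ContDiff ℝ ∞ (dslope f 0) := by
  rw [funext (dslope_zero_eq_integral_deriv (hf.of_le (by norm_cast))), contDiff_infty]
  intro n
  simpa using contDiff_integral_pow_mul_comp_mul
    (contDiff_infty.1 (contDiff_infty_iff_deriv.1 hf).2 n) 0

theorem analyticAt_dslope_zero {f : ℝ → ℝ} {y : ℝ} (hf : AnalyticAt ℝ f y) :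
    AnalyticAt ℝ (dslope f 0) y := by
  rcases eq_or_ne y 0 with rfl | hy
  · obtain ⟨p, hp⟩ := hf
    exact hp.has_fpower_series_dslope_fslope.analyticAt
  · refine AnalyticAt.congr ?_ (dslope_eventuallyEq_slope_of_ne f hy).symm
    rw [slope_fun_def_field]
    exact (hf.sub analyticAt_const).div (analyticAt_id.sub analyticAt_const) (by simpa using hy)

theorem dslope_zero_pos {f : ℝ → ℝ} (hf : StrictMono f) (hd : 0 < deriv f 0) (y : ℝ) :
    0 < dslope f 0 y := by
  rcases eq_or_ne y 0 with rfl | hy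
  · simpa using hd
  · rw [dslope_of_ne _ hy, slope_def_field]
    rcases hy.lt_or_gt with h | h
    · exact div_pos_of_neg_of_neg (by linarith [hf h]) (by linarith)
    · exact div_pos (by linarith [hf h]) (by linarith)

theorem StrictMono.deriv_pos_of_leftInverse {f g : ℝ → ℝ} {x : ℝ} (hf : StrictMono f)
    (hfd : DifferentiableAt ℝ f x) (hgd : DifferentiableAt ℝ g (f x))
    (hgf : Function.LeftInverse g f) : 0 < deriv f x := by
  refine lt_of_le_of_ne hf.monotone.deriv_nonneg fun h ↦ ?_
  have h₁ := hgd.hasDerivAt.comp x hfd.hasDerivAt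
  rw [hgf.comp_eq_id, ← h, mul_zero] at h₁
  exact zero_ne_one (h₁.unique (hasDerivAt_id x))

/-- If `F x ^ s = f (x ^ s)`, then `F` is `x` times the `s`-th root of a positive function. -/
theorem eq_mul_dslope_rpow {s : ℕ} (hs : Odd s) {f F : ℝ → ℝ} (hf0 : f 0 = 0)
    (hpos : ∀ y, 0 < dslope f 0 y) (hF : ∀ x, F x ^ s = f (x ^ s)) :
    F = fun x ↦ x * dslope f 0 (x ^ s) ^ ((1 : ℝ) / s) := by
  funext x
  apply hs.strictMono_pow.injective
  have h := sub_smul_dslope f 0 (x ^ s)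
  simp only [sub_zero, hf0, smul_eq_mul] at h
  simp only [hF]
  rw [mul_pow, one_div, Real.rpow_inv_natCast_pow (hpos _).le hs.pos.ne', h]

theorem contDiff_of_pow_eq_comp_pow {s : ℕ} (hs : Odd s) {f F : ℝ → ℝ} (hf0 : f 0 = 0)
    (hf : ContDiff ℝ ∞ f) (hpos : ∀ y, 0 < dslope f 0 y) (hF : ∀ x, F x ^ s = f (x ^ s)) :
    ContDiff ℝ ∞ F := by
  rw [eq_mul_dslope_rpow hs hf0 hpos hF]
  exact contDiff_id.mul (((contDiff_dslope_zero hf).comp (contDiff_id.pow s)).rpow_const_of_ne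
    fun x ↦ (hpos _).ne')

theorem analyticAt_of_pow_eq_comp_pow {s : ℕ} (hs : Odd s) {f F : ℝ → ℝ} (hf0 : f 0 = 0)
    (hpos : ∀ y, 0 < dslope f 0 y) (hF : ∀ x, F x ^ s = f (x ^ s)) {x : ℝ}
    (hf : AnalyticAt ℝ f (x ^ s)) : AnalyticAt ℝ F x := by
  rw [eq_mul_dslope_rpow hs hf0 hpos hF]
  have h : AnalyticAt ℝ (fun x : ℝ ↦ dslope f 0 (x ^ s)) x :=
    (analyticAt_dslope_zero hf).comp_of_eq (analyticAt_id.fun_pow s) rfl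
  exact analyticAt_id.mul ((h.contDiffAt (n := ω)).rpow_const_of_ne (hpos _).ne').analyticAt

theorem sign_mul_abs_rpow_pow {s : ℕ} (hs : Odd s) (y : ℝ) :
    (Real.sign y * |y| ^ ((1 : ℝ) / s)) ^ s = y := by
  rw [mul_pow, one_div, Real.rpow_inv_natCast_pow (abs_nonneg y) hs.pos.ne']
  rcases lt_trichotomy y 0 with h | rfl | h
  · rw [Real.sign_of_neg h, hs.neg_one_pow, abs_of_neg h]; ring
  · simp
  · rw [Real.sign_of_pos h, one_pow, abs_of_pos h, one_mul]

/-- Ramified lift under `x ↦ x^s` (`s` odd) of a smooth diffeomorphism of `ℝ` fixing `0`: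
`f̂(x) = sgn(f(x^s))·|f(x^s)|^(1/s)` is again a strictly increasing smooth diffeomorphism,
satisfies `f̂(x)^s = f(x^s)`, and is analytic whenever `f` is. -/
theorem ramified_lift_is_diffeo
    (s : ℕ) (hs : 1 ≤ s) (hodd : Odd s) (f : ℝ → ℝ)
    (hmono : StrictMono f) (hbij : Function.Bijective f)
    (hdiff : ContDiff ℝ ∞ f)
    (hinv : ∃ finv : ℝ → ℝ, ContDiff ℝ ∞ finv ∧
      Function.LeftInverse finv f ∧ Function.RightInverse finv f)
    (hf0 : f 0 = 0)
    (fhat : ℝ → ℝ)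
    (hfhat : ∀ x : ℝ, fhat x = Real.sign (f (x ^ s)) * |f (x ^ s)| ^ ((1 : ℝ) / s)) :
    StrictMono fhat ∧ Function.Bijective fhat ∧ ContDiff ℝ ∞ fhat ∧
      (∃ g : ℝ → ℝ, ContDiff ℝ ∞ g ∧
        Function.LeftInverse g fhat ∧ Function.RightInverse g fhat) ∧
      fhat 0 = 0 ∧ (∀ x : ℝ, fhat x ^ s = f (x ^ s)) ∧
      ((∀ x : ℝ, AnalyticAt ℝ f x) → ∀ x : ℝ, AnalyticAt ℝ fhat x) := by
  obtain ⟨finv, hinvdiff, hleft, hright⟩ := hinv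
  have hpow : StrictMono fun x : ℝ ↦ x ^ s := hodd.strictMono_pow
  have hF : ∀ x, fhat x ^ s = f (x ^ s) := fun x ↦ by
    rw [hfhat, sign_mul_abs_rpow_pow hodd]
  have hinv0 : finv 0 = 0 := by simpa [hf0] using hleft 0
  have hinvmono : StrictMono finv := fun a b hab ↦ by
    rwa [← hmono.lt_iff_lt, hright a, hright b]
  have htop : (∞ : WithTop ℕ∞) ≠ 0 := by simp
  have hpos := dslope_zero_pos hmono (hmono.deriv_pos_of_leftInverse
    (hdiff.differentiable htop _) (hinvdiff.differentiable htop _) hleft)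
  have hinvpos := dslope_zero_pos hinvmono (hinvmono.deriv_pos_of_leftInverse
    (hinvdiff.differentiable htop _) (hdiff.differentiable htop _) hright)
  let g : ℝ → ℝ := fun x ↦ Real.sign (finv (x ^ s)) * |finv (x ^ s)| ^ ((1 : ℝ) / s)
  have hg : ∀ x, g x ^ s = finv (x ^ s) := fun x ↦ sign_mul_abs_rpow_pow hodd _
  have hgF : Function.LeftInverse g fhat := fun x ↦ hpow.injective <| by
    simp only [hg, hF, hleft (x ^ s)]
  have hFg : Function.RightInverse g fhat := fun x ↦ hpow.injective <| by
    simp only [hg, hF, hright (x ^ s)]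
  refine ⟨fun a b hab ↦ ?_, ⟨hgF.injective, hFg.surjective⟩,
    contDiff_of_pow_eq_comp_pow hodd hf0 hdiff hpos hF,
    ⟨g, contDiff_of_pow_eq_comp_pow hodd hinv0 hinvdiff hinvpos hg, hgF, hFg⟩, ?_, hF,
    fun hf x ↦ analyticAt_of_pow_eq_comp_pow hodd hf0 hpos hF (hf _)⟩
  · rw [← hpow.lt_iff_lt]
    simpa only [hF] using hmono (hpow hab)
  · simp [hfhat, hf0, hodd.pos.ne']

end
end
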